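/- For every positive integer h and every δ with 0 < δ < 1, there exists a constant c = c(h, δ) > 0 such that for all sufficiently large x, the number of integers n ≤ x for which both φ(n) and λ(n) are (1+1/h)-dense in [h, x^c] exceeds (1 − δ)x. -/

import Mathlib

open scoped Classical

open Filter

/-- The Carmichael function: the exponent of the unit group `(ℤ/nℤ)ˣ`. -/
noncomputable def carmichael (n : ℕ) : ℕ := Monoid.exponent (ZMod n)ˣ

/-- `n` is `u`-dense in the set `I`. -/
def DenseDivIn (n : ℕ) (u : ℝ) (I : Set ℝ) : Prop :=
  ∀ y ∈ I, ∃ d : ℕ, d ∣ n ∧ y < (d : ℝ) ∧ (d : ℝ) ≤ u * y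

/-- The sum of `∏ p ∈ s, (-g p)` over the subsets `s` of `P` with at most `k` elements: the
truncation at level `k` of the expansion of `∏ p ∈ P, (1 - g p)`. -/
noncomputable def truncProd (g : ℕ → ℝ) (P : Finset ℕ) (k : ℕ) : ℝ :=
  ∑ s ∈ P.powerset with s.card ≤ k, ∏ p ∈ s, (-g p)

lemma truncProd_empty (g : ℕ → ℝ) (k : ℕ) : truncProd g ∅ k = 1 := by
  simp [truncProd, Finset.filter_singleton]

lemma truncProd_zero (g : ℕ → ℝ) (P : Finset ℕ) : truncProd g P 0 = 1 := by
  have : (P.powerset.filter fun s => s.card ≤ 0) = {∅} := by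
    ext s; simp; rintro rfl; simp
  simp only [truncProd, this]
  simp

lemma truncProd_insert (g : ℕ → ℝ) {P : Finset ℕ} {q : ℕ} (hq : q ∉ P) (k : ℕ) :
    truncProd g (insert q P) (k + 1) = truncProd g P (k + 1) - g q * truncProd g P k := by
  simp only [truncProd, Finset.sum_filter]
  rw [Finset.sum_powerset_insert hq, sub_eq_add_neg, Finset.mul_sum, ← Finset.sum_neg_distrib]
  congr 1
  refine Finset.sum_congr rfl fun s hs => ?_
  have hqs : q ∉ s := fun h => hq (Finset.mem_powerset.1 hs h)
  rw [Finset.card_insert_of_notMem hqs, Finset.prod_insert hqs]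
  by_cases h : s.card ≤ k <;> simp [h]

lemma pow_add_mul_pow_le {S g : ℝ} (hS : 0 ≤ S) (hg : 0 ≤ g) (n : ℕ) :
    S ^ (n + 1) + (n + 1 : ℕ) * g * S ^ n ≤ (g + S) ^ (n + 1) := by
  induction n with
  | zero => simp [add_comm]
  | succ n ih =>
    calc S ^ (n + 1 + 1) + (n + 1 + 1 : ℕ) * g * S ^ (n + 1)
        ≤ (S ^ (n + 1) + (n + 1 : ℕ) * g * S ^ n) * (g + S) := by
          have : 0 ≤ (n + 1 : ℕ) * g * S ^ n * g := by positivity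
          push_cast at this ⊢
          ring_nf at this ⊢
          linarith
      _ ≤ (g + S) ^ (n + 1) * (g + S) := by gcongr
      _ = (g + S) ^ (n + 1 + 1) := by ring

lemma pow_div_factorial_add_le {S g : ℝ} (hS : 0 ≤ S) (hg : 0 ≤ g) (k : ℕ) :
    S ^ (k + 2) / (k + 2).factorial + g * (S ^ (k + 1) / (k + 1).factorial) ≤
      (g + S) ^ (k + 2) / (k + 2).factorial := by
  have h1 : S ^ (k + 2) + (k + 2) * g * S ^ (k + 1) ≤ (g + S) ^ (k + 2) := by
    exact_mod_cast pow_add_mul_pow_le hS hg (k + 1)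
  have h2 : ((k + 2).factorial : ℝ) = (k + 2) * (k + 1).factorial := by
    rw [Nat.factorial_succ]; push_cast; ring
  have h3 : (0 : ℝ) < (k + 1).factorial := by exact_mod_cast Nat.factorial_pos _
  have h4 : g * (S ^ (k + 1) / (k + 1).factorial) =
      ((k + 2) * g * S ^ (k + 1)) / (k + 2).factorial := by
    rw [h2]; field_simp
  rw [h4, ← add_div]
  gcongr

/-- Bonferroni's inequalities, with an explicit error term. -/
lemma bonferroni {g : ℕ → ℝ} {P : Finset ℕ} (hg : ∀ p ∈ P, 0 ≤ g p ∧ g p ≤ 1) (k : ℕ) :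
    0 ≤ (-1) ^ k * (truncProd g P k - ∏ p ∈ P, (1 - g p)) ∧
    (-1) ^ k * (truncProd g P k - ∏ p ∈ P, (1 - g p)) ≤
      (∑ p ∈ P, g p) ^ (k + 1) / (k + 1).factorial := by
  induction P using Finset.induction_on generalizing k with
  | empty => simp [truncProd_empty]
  | insert q P hq ih =>
    have hgP : ∀ p ∈ P, 0 ≤ g p ∧ g p ≤ 1 := fun p hp => hg p (Finset.mem_insert_of_mem hp)
    obtain ⟨hq0, hq1⟩ := hg q (Finset.mem_insert_self _ _)
    have hS : 0 ≤ ∑ p ∈ P, g p := Finset.sum_nonneg fun p hp => (hgP p hp).1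
    rw [Finset.prod_insert hq, Finset.sum_insert hq]
    cases k with
    | zero =>
      have h0 := ih hgP 0
      simp only [truncProd_zero, pow_zero, one_mul, zero_add, pow_one, Nat.factorial_one,
        Nat.cast_one, div_one] at h0 ⊢
      have hp0 : 0 ≤ ∏ p ∈ P, (1 - g p) :=
        Finset.prod_nonneg fun p hp => by linarith [(hgP p hp).2]
      constructor <;> nlinarith
    | succ k =>
      have h0 := ih hgP (k + 1)
      have h1 := ih hgP k
      rw [truncProd_insert g hq]
      have h2 : (-1 : ℝ) ^ (k + 1) * (truncProd g P (k + 1) - g q * truncProd g P k -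
          (1 - g q) * ∏ p ∈ P, (1 - g p)) =
          (-1) ^ (k + 1) * (truncProd g P (k + 1) - ∏ p ∈ P, (1 - g p)) +
          g q * ((-1) ^ k * (truncProd g P k - ∏ p ∈ P, (1 - g p))) := by
        rw [pow_succ]; ring
      rw [h2]
      refine ⟨add_nonneg h0.1 (mul_nonneg hq0 h1.1), ?_⟩
      refine le_trans (add_le_add h0.2 (mul_le_mul_of_nonneg_left h1.2 hq0)) ?_
      exact pow_div_factorial_add_le hS hq0 k

/-- The number of integers in `(0, N]` in prescribed residue classes modulo distinct primes, by the
Chinese remainder theorem. -/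
lemma abs_sum_residue_sub_le {Ω : ℕ → Finset ℕ} (N : ℕ) {s : Finset ℕ}
    (hs : ∀ p ∈ s, p.Prime) (hΩ : ∀ p ∈ s, Ω p ⊆ Finset.range p) {d : ℕ} (hd : 0 < d)
    (hds : ∀ p ∈ s, d.Coprime p) (c : ℕ) :
    |(∑ m ∈ Finset.Ioc 0 N, (if m ≡ c [MOD d] then (1 : ℝ) else 0) *
      ∏ p ∈ s, (if m % p ∈ Ω p then (1 : ℝ) else 0)) -
      N / d * ∏ p ∈ s, ((Ω p).card / p : ℝ)| ≤ ∏ p ∈ s, ((Ω p).card : ℝ) := by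
  induction s using Finset.induction_on generalizing d c with
  | empty =>
    simp only [Finset.prod_empty, mul_one, Finset.sum_boole]
    have hd' : (0 : ℚ) < d := by exact_mod_cast hd
    have h1 := Nat.Ioc_filter_modEq_card 0 N hd c
    have h2 : (((Finset.Ioc 0 N).filter fun m => m ≡ c [MOD d]).card : ℤ) =
        ⌊((N : ℚ) - c) / d⌋ - ⌊((0 : ℕ) - c : ℚ) / d⌋ := by
      rw [h1, max_eq_left]
      rw [sub_nonneg]
      apply Int.floor_le_floor
      gcongr
      simp
    have h3 : |(((Finset.Ioc 0 N).filter fun m => m ≡ c [MOD d]).card : ℚ) - N / d| ≤ 1 := by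
      have h4 : (((Finset.Ioc 0 N).filter fun m => m ≡ c [MOD d]).card : ℚ) =
        ⌊((N : ℚ) - c) / d⌋ - ⌊((0 : ℕ) - c : ℚ) / d⌋ := by exact_mod_cast h2
      have h5 : ((N : ℚ) - c) / d - ((0 : ℕ) - c : ℚ) / d = N / d := by
        rw [← sub_div]; simp
      rw [h4, abs_le]
      constructor <;> linarith [Int.floor_le (((N : ℚ) - c) / d),
        Int.lt_floor_add_one (((N : ℚ) - c) / d), Int.floor_le (((0 : ℕ) - c : ℚ) / d),
        Int.lt_floor_add_one (((0 : ℕ) - c : ℚ) / d)]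
    have h6 := (Rat.cast_le (K := ℝ)).2 h3
    push_cast at h6
    simpa using h6
  | insert q s hq ih =>
    have hqp := hs q (Finset.mem_insert_self _ _)
    have hdq := hds q (Finset.mem_insert_self _ _)
    have hind : ∀ m : ℕ, (if m % q ∈ Ω q then (1 : ℝ) else 0) =
        ∑ a ∈ Ω q, if m ≡ a [MOD q] then (1 : ℝ) else 0 := by
      intro m
      have : ∀ a ∈ Ω q, (if m ≡ a [MOD q] then (1 : ℝ) else 0) = if m % q = a then 1 else 0 := by
        intro a ha
        have : a % q = a := Nat.mod_eq_of_lt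
          (Finset.mem_range.1 (hΩ q (Finset.mem_insert_self _ _) ha))
        simp [Nat.ModEq, this]
      rw [Finset.sum_congr rfl this, Finset.sum_ite_eq]
    have key : ∀ m a : ℕ, (if m ≡ c [MOD d] then (1 : ℝ) else 0) *
        (if m ≡ a [MOD q] then (1 : ℝ) else 0) =
        if m ≡ Nat.chineseRemainder hdq c a [MOD d * q] then 1 else 0 := by
      intro m a
      have h1 := (Nat.chineseRemainder hdq c a).2
      have : m ≡ Nat.chineseRemainder hdq c a [MOD d * q] ↔ m ≡ c [MOD d] ∧ m ≡ a [MOD q] := by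
        rw [← Nat.modEq_and_modEq_iff_modEq_mul hdq]
        exact ⟨fun h => ⟨h.1.trans h1.1, h.2.trans h1.2⟩,
          fun h => ⟨h.1.trans h1.1.symm, h.2.trans h1.2.symm⟩⟩
      by_cases hc : m ≡ c [MOD d] <;> by_cases ha : m ≡ a [MOD q] <;> simp [this, hc, ha]
    have hexp : ∑ m ∈ Finset.Ioc 0 N, (if m ≡ c [MOD d] then (1 : ℝ) else 0) *
        ∏ p ∈ insert q s, (if m % p ∈ Ω p then (1 : ℝ) else 0) =
        ∑ a ∈ Ω q, ∑ m ∈ Finset.Ioc 0 N,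
          (if m ≡ Nat.chineseRemainder hdq c a [MOD d * q] then (1 : ℝ) else 0) *
          ∏ p ∈ s, (if m % p ∈ Ω p then (1 : ℝ) else 0) := by
      rw [Finset.sum_comm]
      refine Finset.sum_congr rfl fun m _ => ?_
      rw [Finset.prod_insert hq, hind, ← Finset.sum_mul, ← mul_assoc, Finset.mul_sum]
      simp only [key]
    rw [hexp, Finset.prod_insert hq, Finset.prod_insert hq]
    have hmain : (N : ℝ) / d * ((Ω q).card / q * ∏ p ∈ s, ((Ω p).card / p : ℝ)) =
        ∑ a ∈ Ω q, (N : ℝ) / (d * q : ℕ) * ∏ p ∈ s, ((Ω p).card / p : ℝ) := by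
      rw [Finset.sum_const, nsmul_eq_mul]
      have := hqp.pos
      push_cast
      field_simp
    rw [hmain, ← Finset.sum_sub_distrib]
    refine (Finset.abs_sum_le_sum_abs _ _).trans ?_
    rw [← nsmul_eq_mul]
    refine Finset.sum_le_card_nsmul _ _ _ fun a _ => ?_
    refine ih (fun p hp => hs p (Finset.mem_insert_of_mem hp))
      (fun p hp => hΩ p (Finset.mem_insert_of_mem hp)) (Nat.mul_pos hd hqp.pos)
      (fun p hp => Nat.Coprime.mul_left (hds p (Finset.mem_insert_of_mem hp)) ?_) _
    exact (Nat.coprime_primes hqp (hs p (Finset.mem_insert_of_mem hp))).2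
      (fun h => hq (h ▸ hp))

lemma truncProd_residue_expand {n : ℕ} {P : Fin n → Finset ℕ}
    (hdisj : ∀ i j, i ≠ j → Disjoint (P i) (P j)) (k : Fin n → ℕ) (g : ℕ → ℝ) :
    ∏ j, truncProd g (P j) (k j) =
      ∑ x ∈ Fintype.piFinset (fun j => (P j).powerset.filter fun s => s.card ≤ k j),
        (∏ j, (-1 : ℝ) ^ (x j).card) * ∏ p ∈ Finset.univ.biUnion x, g p := by
  simp only [truncProd]
  rw [Finset.prod_univ_sum]
  refine Finset.sum_congr rfl fun x hx => ?_
  have hx' : ∀ j, x j ⊆ P j := fun j => by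
    have := Fintype.mem_piFinset.1 hx j
    simp only [Finset.mem_filter, Finset.mem_powerset] at this
    exact this.1
  rw [Finset.prod_biUnion, ← Finset.prod_mul_distrib]
  · refine Finset.prod_congr rfl fun j _ => ?_
    rw [Finset.prod_neg]
  · intro i _ j _ hij
    exact Finset.disjoint_of_subset_left (hx' i)
      (Finset.disjoint_of_subset_right (hx' j) (hdisj i j hij))

/-- The sum of a product of truncations over an interval is its expected value, up to an error. -/
lemma sum_prod_truncProd_le {n : ℕ} {P : Fin n → Finset ℕ} {Ω : ℕ → Finset ℕ}
    (hdisj : ∀ i j, i ≠ j → Disjoint (P i) (P j)) (k : Fin n → ℕ)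
    (hP : ∀ j, ∀ p ∈ P j, p.Prime) (hΩ : ∀ j, ∀ p ∈ P j, Ω p ⊆ Finset.range p) (N : ℕ) :
    ∑ m ∈ Finset.Ioc 0 N,
        ∏ j, truncProd (fun p => if m % p ∈ Ω p then (1 : ℝ) else 0) (P j) (k j) ≤
      N * ∏ j, truncProd (fun p => ((Ω p).card / p : ℝ)) (P j) (k j) +
        ∏ j, ∑ s ∈ (P j).powerset with s.card ≤ k j, ∏ p ∈ s, ((Ω p).card : ℝ) := by
  simp only [truncProd_residue_expand hdisj]
  rw [Finset.sum_comm, Finset.mul_sum, ← sub_le_iff_le_add', ← Finset.sum_sub_distrib,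
    Finset.prod_univ_sum]
  refine Finset.sum_le_sum fun x hx => ?_
  have hx' : ∀ j, x j ⊆ P j := fun j => by
    have := Fintype.mem_piFinset.1 hx j
    simp only [Finset.mem_filter, Finset.mem_powerset] at this
    exact this.1
  have hU : ∀ p ∈ Finset.univ.biUnion x, ∃ j, p ∈ P j := by
    intro p hp
    obtain ⟨j, _, hj⟩ := Finset.mem_biUnion.1 hp
    exact ⟨j, hx' j hj⟩
  have h1 := abs_sum_residue_sub_le (Ω := Ω) N (s := Finset.univ.biUnion x)
    (fun p hp => (hU p hp).elim fun j hj => hP j p hj)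
    (fun p hp => (hU p hp).elim fun j hj => hΩ j p hj) one_pos (fun p _ => Nat.coprime_one_left p) 0
  simp only [Nat.modEq_one, if_true, one_mul, Nat.cast_one, div_one] at h1
  have h2 : ∏ p ∈ Finset.univ.biUnion x, ((Ω p).card : ℝ) = ∏ j, ∏ p ∈ x j, ((Ω p).card : ℝ) := by
    rw [Finset.prod_biUnion]
    intro i _ j _ hij
    exact Finset.disjoint_of_subset_left (hx' i)
      (Finset.disjoint_of_subset_right (hx' j) (hdisj i j hij))
  rw [← h2, ← Finset.mul_sum, mul_left_comm, ← mul_sub]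
  refine (le_abs_self _).trans ?_
  rw [abs_mul, Finset.abs_prod]
  simpa using h1

lemma sum_powerset_card_le {P : Finset ℕ} {ρ : ℕ → ℕ} (hρ : ∀ p ∈ P, ρ p ≤ 2) (k : ℕ) :
    ∑ s ∈ P.powerset with s.card ≤ k, ∏ p ∈ s, (ρ p : ℝ) ≤ (1 + 2 * P.card : ℝ) ^ k := by
  calc ∑ s ∈ P.powerset with s.card ≤ k, ∏ p ∈ s, (ρ p : ℝ)
      ≤ ∑ s ∈ P.powerset with s.card ≤ k, (2 : ℝ) ^ s.card := by
        refine Finset.sum_le_sum fun s hs => ?_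
        simp only [Finset.mem_filter, Finset.mem_powerset] at hs
        refine (Finset.prod_le_prod (fun _ _ => by positivity)
          (fun p hp => (by exact_mod_cast hρ p (hs.1 hp) : (ρ p : ℝ) ≤ 2))).trans ?_
        simp
    _ = ∑ i ∈ Finset.range (k + 1), ∑ s ∈ P.powersetCard i, (2 : ℝ) ^ s.card := by
        rw [← Finset.sum_biUnion]
        · refine Finset.sum_congr ?_ fun _ _ => rfl
          ext s
          simp only [Finset.mem_filter, Finset.mem_powerset, Finset.mem_biUnion, Finset.mem_range,
            Finset.mem_powersetCard]
          exact ⟨fun h => ⟨s.card, by omega, h.1, rfl⟩,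
            fun ⟨a, ha, h1, h2⟩ => ⟨h1, by omega⟩⟩
        · intro i _ j _ hij
          exact Finset.pairwise_disjoint_powersetCard P hij
    _ = ∑ i ∈ Finset.range (k + 1), (P.card.choose i : ℝ) * 2 ^ i := by
        refine Finset.sum_congr rfl fun i _ => ?_
        rw [Finset.sum_congr rfl fun s hs => by rw [(Finset.mem_powersetCard.1 hs).2]]
        simp
    _ ≤ ∑ i ∈ Finset.range (k + 1), 1 ^ i * (2 * P.card : ℝ) ^ (k - i) * (k.choose i) := by
        rw [← Finset.sum_range_reflect]
        refine Finset.sum_le_sum fun i hi => ?_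
        have hik : i ≤ k := Nat.lt_succ_iff.1 (Finset.mem_range.1 hi)
        have h1 : k + 1 - 1 - i = k - i := by omega
        rw [h1, one_pow, one_mul, mul_pow]
        have h2 : (P.card.choose (k - i) : ℝ) ≤ (P.card : ℝ) ^ (k - i) := by
          exact_mod_cast Nat.choose_le_pow _ _
        have h3 : (1 : ℝ) ≤ k.choose i := by exact_mod_cast Nat.choose_pos hik
        calc (P.card.choose (k - i) : ℝ) * 2 ^ (k - i) ≤ (P.card : ℝ) ^ (k - i) * 2 ^ (k - i) := by
              gcongr
          _ = 2 ^ (k - i) * (P.card : ℝ) ^ (k - i) * 1 := by ring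
          _ ≤ _ := by gcongr
    _ = (1 + 2 * P.card : ℝ) ^ k := by rw [add_pow]

lemma exp_neg_three_mul_le {g : ℝ} (hg0 : 0 ≤ g) (hg : g ≤ 2 / 3) : Real.exp (-(3 * g)) ≤ 1 - g := by
  rw [Real.exp_neg, inv_le_comm₀ (Real.exp_pos _) (by linarith)]
  have h1 : (1 - g)⁻¹ ≤ 3 * g + 1 := by
    rw [inv_le_iff_one_le_mul₀ (by linarith)]
    nlinarith
  exact h1.trans (Real.add_one_le_exp _)

lemma truncProd_le_prod_mul_exp {g : ℕ → ℝ} {P : Finset ℕ} (hg : ∀ p ∈ P, 0 ≤ g p ∧ g p ≤ 2 / 3)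
    {S : ℝ} (hS : ∑ p ∈ P, g p ≤ S) {k : ℕ} (hk : Even k) :
    truncProd g P k ≤ (∏ p ∈ P, (1 - g p)) *
      Real.exp (Real.exp (3 * S) * (S ^ (k + 1) / (k + 1).factorial)) := by
  have h1 := (bonferroni (P := P) (fun p hp => ⟨(hg p hp).1, by linarith [(hg p hp).2]⟩) k).2
  rw [hk.neg_one_pow, one_mul, sub_le_iff_le_add'] at h1
  have hS0 : 0 ≤ ∑ p ∈ P, g p := Finset.sum_nonneg fun p hp => (hg p hp).1
  have h2 : Real.exp (-(3 * S)) ≤ ∏ p ∈ P, (1 - g p) := by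
    calc Real.exp (-(3 * S)) ≤ Real.exp (∑ p ∈ P, -(3 * g p)) := by
          rw [Finset.sum_neg_distrib, ← Finset.mul_sum]
          gcongr
      _ = ∏ p ∈ P, Real.exp (-(3 * g p)) := Real.exp_sum _ _
      _ ≤ _ := Finset.prod_le_prod (fun _ _ => (Real.exp_pos _).le)
          fun p hp => exp_neg_three_mul_le (hg p hp).1 (hg p hp).2
  set V := ∏ p ∈ P, (1 - g p)
  set e := S ^ (k + 1) / (k + 1).factorial with he
  have he' : (∑ p ∈ P, g p) ^ (k + 1) / (k + 1).factorial ≤ e := by rw [he]; gcongr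
  have he0 : 0 ≤ e := le_trans (by positivity) he'
  have h3 : e ≤ V * (Real.exp (3 * S) * e) := by
    rw [← mul_assoc]
    refine le_mul_of_one_le_left he0 ?_
    calc (1 : ℝ) = Real.exp (-(3 * S)) * Real.exp (3 * S) := by rw [← Real.exp_add]; simp
      _ ≤ _ := by gcongr
  have hV : 0 < V := lt_of_lt_of_le (Real.exp_pos _) h2
  calc truncProd g P k ≤ V * (Real.exp (3 * S) * e + 1) := by linarith
    _ ≤ _ := by
      gcongr
      exact Real.add_one_le_exp _

lemma sum_range_sum_Ioc {u : ℕ → ℕ} (hu : Monotone u) (f : ℕ → ℝ) (n : ℕ) :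
    ∑ i ∈ Finset.range n, ∑ m ∈ Finset.Ioc (u i) (u (i + 1)), f m =
      ∑ m ∈ Finset.Ioc (u 0) (u n), f m := by
  induction n with
  | zero => simp
  | succ n ih =>
    rw [Finset.sum_range_succ, ih,
      Finset.sum_Ioc_consecutive _ (hu (Nat.zero_le n)) (hu (Nat.le_succ n))]

/-- The sum of `1 / p` over the primes `p ∈ (a, b]` satisfying `G`. -/
noncomputable def primeRecipSum (G : ℕ → Prop) (a b : ℕ) : ℝ :=
  ∑ p ∈ Finset.Ioc a b with p.Prime ∧ G p, (1 / p : ℝ)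

lemma primeRecipSum_eq (G : ℕ → Prop) (a b : ℕ) :
    primeRecipSum G a b = ∑ p ∈ Finset.Ioc a b, if p.Prime ∧ G p then (1 / p : ℝ) else 0 :=
  Finset.sum_filter _ _

lemma sum_range_primeRecipSum (G : ℕ → Prop) {u : ℕ → ℕ} (hu : Monotone u) (n : ℕ) :
    ∑ i ∈ Finset.range n, primeRecipSum G (u i) (u (i + 1)) = primeRecipSum G (u 0) (u n) := by
  simp only [primeRecipSum_eq]
  exact sum_range_sum_Ioc hu _ n

lemma primeRecipSum_le_card (G : ℕ → Prop) {a b : ℕ} (ha : 0 < a) :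
    primeRecipSum G a b ≤ ((Finset.Ioc a b).filter fun p => p.Prime ∧ G p).card / a := by
  rw [primeRecipSum, div_eq_mul_one_div, ← nsmul_eq_mul]
  refine Finset.sum_le_card_nsmul _ _ _ fun p hp => ?_
  have := (Finset.mem_Ioc.1 (Finset.mem_filter.1 hp).1).1
  have h' : (0 : ℝ) < a := by exact_mod_cast ha
  gcongr

lemma primeRecipSum_add_not (G : ℕ → Prop) (a b : ℕ) :
    primeRecipSum G a b + primeRecipSum (fun p => ¬ G p) a b =
      primeRecipSum (fun _ => True) a b := by
  simp only [primeRecipSum_eq, ← Finset.sum_add_distrib]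
  refine Finset.sum_congr rfl fun p _ => ?_
  by_cases hp : p.Prime <;> by_cases hG : G p <;> simp [hp, hG]

lemma theta_two_pow_eq (l : ℕ) :
    Chebyshev.theta (2 ^ l : ℝ) =
      ∑ p ∈ Finset.Ioc 0 (2 ^ l : ℕ) with Nat.Prime p, Real.log (p : ℝ) := by
  have : ⌊(2 ^ l : ℝ)⌋₊ = 2 ^ l := by exact_mod_cast Nat.floor_natCast (R := ℝ) (2 ^ l)
  rw [Chebyshev.theta, this]

lemma primeRecipSum_dyadic_le {l : ℕ} (hl : 0 < l) :
    primeRecipSum (fun _ => True) (2 ^ l) (2 ^ (l + 1)) ≤ 4 / l := by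
  have h2 : Real.log 4 = 2 * Real.log 2 := by
    rw [show (4 : ℝ) = 2 ^ 2 by norm_num, Real.log_pow]; norm_num
  have h3 : 0 < Real.log 2 := Real.log_pos (by norm_num)
  have hl' : (0 : ℝ) < l := by exact_mod_cast hl
  have h1 : (l * Real.log 2 * 2 ^ l) * primeRecipSum (fun _ => True) (2 ^ l) (2 ^ (l + 1)) ≤
      Real.log 4 * 2 ^ (l + 1) := by
    calc (l * Real.log 2 * 2 ^ l) * primeRecipSum (fun _ => True) (2 ^ l) (2 ^ (l + 1))
        ≤ ∑ p ∈ Finset.Ioc (2 ^ l) (2 ^ (l + 1)), if p.Prime then Real.log (p : ℝ) else 0 := by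
          rw [primeRecipSum_eq, Finset.mul_sum]
          refine Finset.sum_le_sum fun p hp => ?_
          by_cases h : p.Prime
          · simp only [h, if_true, and_true]
            have hp0 : (0 : ℝ) < p := by exact_mod_cast h.pos
            have hp1 : (2 ^ l : ℝ) ≤ p := by exact_mod_cast (Finset.mem_Ioc.1 hp).1.le
            have hp2 : l * Real.log 2 ≤ Real.log p := by
              rw [← Real.log_pow]
              exact Real.log_le_log (by positivity) hp1
            rw [mul_one_div, div_le_iff₀ hp0]
            exact mul_le_mul hp2 hp1 (by positivity) (le_trans (by positivity) hp2)
          · simp [h]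
      _ ≤ Chebyshev.theta (2 ^ (l + 1) : ℝ) := by
        rw [theta_two_pow_eq, Finset.sum_filter]
        refine Finset.sum_le_sum_of_subset_of_nonneg ?_ fun p hp _ => ?_
        · exact Finset.Ioc_subset_Ioc_left (Nat.zero_le _)
        · split_ifs
          · exact Real.log_natCast_nonneg p
          · exact le_rfl
      _ ≤ _ := Chebyshev.theta_le_log4_mul_x (by positivity)
  rw [h2, pow_succ (2 : ℝ)] at h1
  rw [le_div_iff₀ hl']
  have h7 : (0 : ℝ) < 2 ^ l * Real.log 2 := by positivity
  refine le_of_mul_le_mul_right ?_ h7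
  linarith

lemma eventually_le_theta_two_pow : ∀ᶠ l : ℕ in atTop,
    (2 ^ l : ℝ) * (Real.log 2 / 2) ≤ Chebyshev.theta (2 ^ l : ℝ) := by
  have h3 : 0 < Real.log 2 := Real.log_pos (by norm_num)
  have h1 : ∀ᶠ n : ℝ in atTop, Real.log (n + 1) + 2 * √n * Real.log n ≤ n * (Real.log 2 / 2) := by
    have hlo := (Real.isLittleO_pow_log_id_atTop (n := 2)).bound
      (show 0 < (Real.log 2 / 8) ^ 2 by positivity)
    filter_upwards [hlo, eventually_ge_atTop 2] with n hn hn2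
    rw [Real.norm_of_nonneg (by positivity), id, Real.norm_of_nonneg (by linarith)] at hn
    have h5 : √n * Real.log n ≤ Real.log 2 / 8 * n := by
      refine abs_le_of_sq_le_sq' ?_ (by positivity) |>.2
      rw [mul_pow, mul_pow, Real.sq_sqrt (by linarith)]
      nlinarith
    have h6 : Real.log (n + 1) ≤ 2 * Real.log n := by
      calc Real.log (n + 1) ≤ Real.log (n ^ 2) := Real.log_le_log (by linarith) (by nlinarith)
        _ = 2 * Real.log n := by rw [Real.log_pow]; norm_num
    have h7 : 1 ≤ √n := Real.one_le_sqrt.2 (by linarith)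
    have h8 : 0 ≤ Real.log n := Real.log_nonneg (by linarith)
    nlinarith
  have h2 : Tendsto (fun l : ℕ => (2 : ℝ) ^ l) atTop atTop :=
    tendsto_pow_atTop_atTop_of_one_lt (by norm_num)
  filter_upwards [h2.eventually h1] with l hl
  have := Chebyshev.theta_ge (2 ^ l)
  push_cast at this
  linarith

lemma eventually_le_primeRecipSum_dyadic : ∀ᶠ l : ℕ in atTop,
    3 / (8 * (l + 4)) ≤ primeRecipSum (fun _ => True) (2 ^ l) (2 ^ (l + 4)) := by
  have h0 : ∀ᶠ l : ℕ in atTop,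
      (2 ^ (l + 4) : ℝ) * (Real.log 2 / 2) ≤ Chebyshev.theta (2 ^ (l + 4) : ℝ) :=
    (tendsto_add_atTop_nat 4).eventually eventually_le_theta_two_pow
  filter_upwards [h0] with l hl
  have h3 : 0 < Real.log 2 := Real.log_pos (by norm_num)
  have h2 : Real.log 4 = 2 * Real.log 2 := by
    rw [show (4 : ℝ) = 2 ^ 2 by norm_num, Real.log_pow]; norm_num
  have h4 := Chebyshev.theta_le_log4_mul_x (x := (2 : ℝ) ^ l) (by positivity)
  rw [theta_two_pow_eq, Finset.sum_filter] at hl h4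
  rw [← Finset.sum_Ioc_consecutive _ (Nat.zero_le (2 ^ l))
    (Nat.pow_le_pow_right two_pos (Nat.le_add_right l 4))] at hl
  have h5 : ∑ p ∈ Finset.Ioc (2 ^ l : ℕ) (2 ^ (l + 4)), (if p.Prime then Real.log (p : ℝ) else 0) ≤
      ((l + 4) * Real.log 2 * 2 ^ (l + 4)) *
        primeRecipSum (fun _ => True) (2 ^ l) (2 ^ (l + 4)) := by
    rw [primeRecipSum_eq, Finset.mul_sum]
    refine Finset.sum_le_sum fun p hp => ?_
    by_cases h : p.Prime
    · simp only [h, if_true, and_true]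
      have hp0 : (0 : ℝ) < p := by exact_mod_cast h.pos
      have hp1 : (p : ℝ) ≤ 2 ^ (l + 4) := by exact_mod_cast (Finset.mem_Ioc.1 hp).2
      have hp2 : Real.log p ≤ (l + 4) * Real.log 2 := by
        calc Real.log p ≤ Real.log (2 ^ (l + 4)) := Real.log_le_log hp0 hp1
          _ = _ := by rw [Real.log_pow]; push_cast; ring
      rw [mul_one_div, le_div_iff₀ hp0]
      exact mul_le_mul hp2 hp1 hp0.le (by positivity)
    · simp [h]
  rw [div_le_iff₀ (by positivity)]
  have h6 : (6 * 2 ^ l : ℝ) * Real.log 2 ≤ ((l + 4) * Real.log 2 * 2 ^ (l + 4)) *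
        primeRecipSum (fun _ => True) (2 ^ l) (2 ^ (l + 4)) := by
    rw [h2] at h4
    rw [pow_add (2 : ℝ)] at hl h5 ⊢
    linarith
  have h7 : (0 : ℝ) < 2 ^ l * Real.log 2 := by positivity
  refine le_of_mul_le_mul_right ?_ h7
  rw [pow_add (2 : ℝ)] at h6
  linarith

/-- The doubly exponential sequence `2 ^ 2 ^ j`. -/
def dexp (j : ℕ) : ℕ := 2 ^ 2 ^ j

lemma dexp_zero : dexp 0 = 2 := rfl

lemma dexp_pos (j : ℕ) : 0 < dexp j := by unfold dexp; positivity

lemma dexp_mono : Monotone dexp := fun i j h => by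
  unfold dexp
  exact Nat.pow_le_pow_right two_pos (Nat.pow_le_pow_right two_pos h)

lemma dexp_succ (j : ℕ) : dexp (j + 1) = dexp j ^ 2 := by
  rw [dexp, dexp, ← pow_mul, pow_succ]

lemma primeRecipSum_dexp_le (j : ℕ) :
    primeRecipSum (fun _ => True) (dexp j) (dexp (j + 1)) ≤ 4 := by
  have h1 := sum_range_primeRecipSum (fun _ => True) (u := fun i => 2 ^ (2 ^ j + i))
    (fun a b h => Nat.pow_le_pow_right two_pos (by omega)) (2 ^ j)
  have h2 : (2 : ℕ) ^ (2 ^ j + 2 ^ j) = dexp (j + 1) := by rw [dexp]; ring_nf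
  simp only [add_zero, h2] at h1
  rw [dexp, ← h1]
  calc _ ≤ ∑ i ∈ Finset.range (2 ^ j), (4 / (2 ^ j : ℕ) : ℝ) := by
        refine Finset.sum_le_sum fun i _ => ?_
        have h3 : 0 < 2 ^ j := by positivity
        refine (primeRecipSum_dyadic_le (l := 2 ^ j + i) (by omega)).trans ?_
        gcongr
        omega
    _ = 4 := by simp; field_simp

lemma eventually_le_primeRecipSum_dexp : ∀ᶠ j : ℕ in atTop,
    1 / 32 ≤ primeRecipSum (fun _ => True) (dexp j) (dexp (j + 1)) := by
  obtain ⟨l₀, hl₀⟩ := eventually_atTop.1 eventually_le_primeRecipSum_dyadic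
  filter_upwards [eventually_ge_atTop (max 2 l₀)] with j hj
  obtain ⟨i, rfl⟩ : ∃ i, j = i + 2 := ⟨j - 2, by have := le_max_left 2 l₀; omega⟩
  have h1 := sum_range_primeRecipSum (fun _ => True) (u := fun t => 2 ^ (2 ^ (i + 2) + 4 * t))
    (fun a b h => Nat.pow_le_pow_right two_pos (by omega)) (2 ^ i)
  have h2 : (2 : ℕ) ^ (2 ^ (i + 2) + 4 * 2 ^ i) = dexp (i + 2 + 1) := by rw [dexp]; ring_nf
  simp only [mul_zero, add_zero, h2] at h1
  rw [dexp, ← h1]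
  calc (1 / 32 : ℝ) ≤ ∑ t ∈ Finset.range (2 ^ i), (3 / (8 * (2 ^ (i + 3) : ℕ)) : ℝ) := by
        simp [pow_add]; field_simp; norm_num
    _ ≤ _ := by
        refine Finset.sum_le_sum fun t ht => ?_
        have ht' := Finset.mem_range.1 ht
        have h5 : 2 ^ (i + 2) + 4 * t + 4 ≤ 2 ^ (i + 3) := by
          rw [pow_add, pow_add]; omega
        have h6 : l₀ ≤ 2 ^ (i + 2) + 4 * t :=
          ((le_max_right _ _).trans hj).trans (Nat.lt_two_pow_self.le.trans (Nat.le_add_right _ _))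
        have h7 := hl₀ _ h6
        refine le_trans ?_ h7
        have : (((2 ^ (i + 2) + 4 * t : ℕ) : ℝ) + 4) ≤ (2 ^ (i + 3) : ℕ) := by exact_mod_cast h5
        gcongr

lemma log_le_prod_primesBelow (N : ℕ) :
    Real.log N ≤ ∏ p ∈ N.primesBelow, (1 - (p : ℝ)⁻¹)⁻¹ := by
  let f : ℕ →*₀ ℝ :=
    { toFun := fun n => (n : ℝ)⁻¹
      map_zero' := by simp
      map_one' := by simp
      map_mul' := fun a b => by push_cast; rw [mul_inv] }
  have hf : ∀ n : ℕ, f n = (n : ℝ)⁻¹ := fun n => rfl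
  have h1 := (EulerProduct.summable_and_hasSum_smoothNumbers_prod_primesBelow_geometric
    (f := (f : ℕ →* ℝ))
    (fun {p} hp => by
      change ‖f p‖ < 1
      rw [hf, Real.norm_of_nonneg (by positivity)]
      exact inv_lt_one_of_one_lt₀ (by exact_mod_cast hp.one_lt)) N).2
  change HasSum (fun m : Nat.smoothNumbers N => ((m : ℕ) : ℝ)⁻¹)
    (∏ p ∈ N.primesBelow, (1 - (p : ℝ)⁻¹)⁻¹) at h1
  have h2 : ∑ n ∈ Finset.Icc 1 (N - 1), (n : ℝ)⁻¹ ≤ ∏ p ∈ N.primesBelow, (1 - (p : ℝ)⁻¹)⁻¹ := by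
    have hmem : ∀ n ∈ Finset.Icc 1 (N - 1), n ∈ Nat.smoothNumbers N := fun n hn => by
      obtain ⟨h1, h2⟩ := Finset.mem_Icc.1 hn
      exact Nat.mem_smoothNumbers_of_lt h1 (by omega)
    have h3 := sum_le_hasSum ((Finset.Icc 1 (N - 1)).subtype fun n => n ∈ Nat.smoothNumbers N)
      (fun i _ => by positivity) h1
    rwa [Finset.sum_subtype_of_mem (fun n : ℕ => (n : ℝ)⁻¹) hmem] at h3
  refine le_trans ?_ h2
  rcases N with _ | N
  · simp
  · have := log_add_one_le_harmonic N
    rw [harmonic_eq_sum_Icc] at this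
    push_cast at this ⊢
    exact this

lemma prod_one_sub_inv_le (J : ℕ) :
    ∏ p ∈ Finset.Ioc 2 (dexp J) with p.Prime, (1 - 1 / p : ℝ) ≤ 4 / 2 ^ J := by
  have h1 := log_le_prod_primesBelow (dexp J + 1)
  have h2 : (dexp J + 1).primesBelow =
      insert 2 ((Finset.Ioc 2 (dexp J)).filter Nat.Prime) := by
    ext p
    have h2J : 2 ≤ dexp J := dexp_zero ▸ dexp_mono (Nat.zero_le J)
    simp only [Nat.mem_primesBelow, Finset.mem_insert, Finset.mem_filter, Finset.mem_Ioc]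
    constructor
    · rintro ⟨h, hp⟩
      have := hp.two_le
      by_cases h2 : p = 2
      · exact Or.inl h2
      · exact Or.inr ⟨⟨by omega, by omega⟩, hp⟩
    · rintro (rfl | ⟨h, hp⟩)
      · exact ⟨by omega, Nat.prime_two⟩
      · exact ⟨by omega, hp⟩
  rw [h2, Finset.prod_insert (by simp), Finset.prod_inv_distrib] at h1
  set V := ∏ p ∈ Finset.Ioc 2 (dexp J) with p.Prime, (1 - 1 / p : ℝ)
  have hV' : ∏ p ∈ Finset.Ioc 2 (dexp J) with p.Prime, (1 - (p : ℝ)⁻¹) = V := by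
    simp only [V, one_div]
  have hV : 0 < V := by
    refine Finset.prod_pos fun p hp => ?_
    have := (Finset.mem_Ioc.1 (Finset.mem_filter.1 hp).1).1
    rw [sub_pos, div_lt_one (by positivity)]
    exact_mod_cast (by omega : 1 < p)
  rw [hV'] at h1
  have h3 : 2 ^ J * Real.log 2 ≤ Real.log (dexp J + 1 : ℕ) := by
    calc 2 ^ J * Real.log 2 = Real.log (dexp J) := by
          rw [dexp]; push_cast; rw [Real.log_pow]; push_cast; rfl
      _ ≤ _ := Real.log_le_log (by exact_mod_cast dexp_pos J) (by push_cast; linarith)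
  have h4 := Real.log_two_gt_d9
  have h5 : (2 : ℝ) ^ J / 2 ≤ 2 * V⁻¹ := by
    have h6 : (0 : ℝ) < 2 ^ J := by positivity
    norm_num at h1 h3
    nlinarith
  rw [le_div_iff₀ (by positivity)]
  rw [← div_eq_mul_inv, le_div_iff₀ hV] at h5
  linarith

lemma exists_dexp_lt_le {J p : ℕ} (h2 : 2 < p) (hp : p ≤ dexp J) :
    ∃ j < J, dexp j < p ∧ p ≤ dexp (j + 1) := by
  induction J with
  | zero => rw [dexp_zero] at hp; omega
  | succ J ih =>
    by_cases h : p ≤ dexp J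
    · obtain ⟨j, hj, h1⟩ := ih h
      exact ⟨j, by omega, h1⟩
    · exact ⟨J, by omega, by omega, hp⟩

lemma sum_range_odd_le {a : ℕ → ℝ} (ha : ∀ i, 0 ≤ a i) (J : ℕ) :
    ∑ i ∈ Finset.range J, a (2 * i + 1) ≤ ∑ i ∈ Finset.range (2 * J), a i := by
  induction J with
  | zero => simp
  | succ J ih =>
    rw [Finset.sum_range_succ, show 2 * (J + 1) = 2 * J + 1 + 1 by ring, Finset.sum_range_succ,
      Finset.sum_range_succ]
    linarith [ha (2 * J)]

lemma sum_two_pow_mul_sub_le (J : ℕ) :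
    ∑ j ∈ Finset.range J, 2 ^ j * (J - 1 - j) + J + 1 = 2 ^ J := by
  induction J with
  | zero => simp
  | succ J ih =>
    have h1 : ∑ j ∈ Finset.range (J + 1), 2 ^ j * (J + 1 - 1 - j) =
        ∑ j ∈ Finset.range J, 2 ^ j * (J - 1 - j) + ∑ j ∈ Finset.range J, 2 ^ j := by
      rw [Finset.sum_range_succ, ← Finset.sum_add_distrib]
      simp only [add_tsub_cancel_right, tsub_self, mul_zero, add_zero]
      refine Finset.sum_congr rfl fun j hj => ?_
      have := Finset.mem_range.1 hj
      rw [← mul_add_one]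
      congr 1
      omega
    have h2 := Nat.geomSum_eq (le_refl 2) J
    have h3 : 0 < 2 ^ J := by positivity
    rw [h1, h2, pow_succ]
    simp only [Nat.add_one_sub_one, Nat.div_one]
    omega

/-- The upper bound sieve of Brun and Hooley, in dimension at most two. -/
theorem brun_hooley_sieve : ∃ C : ℝ, 0 < C ∧ ∀ (J N : ℕ) (P : Finset ℕ) (Ω : ℕ → Finset ℕ),
    (∀ p ∈ P, p.Prime ∧ 2 < p ∧ p ≤ dexp J) →
    (∀ p ∈ P, Ω p ⊆ Finset.range p ∧ (Ω p).card ≤ 2) →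
    (((Finset.Ioc 0 N).filter fun m => ∀ p ∈ P, m % p ∉ Ω p).card : ℝ) ≤
      C * N * ∏ p ∈ P, (1 - (Ω p).card / p : ℝ) + (dexp J : ℝ) ^ 8 := by
  refine ⟨Real.exp (Real.exp 24 * Real.exp 8), Real.exp_pos _, fun J N P Ω hP hΩ => ?_⟩
  let Q : Fin J → Finset ℕ := fun j => P.filter fun p => dexp j < p ∧ p ≤ dexp (j + 1)
  have hQ : ∀ j p, p ∈ Q j → p ∈ P := fun j p hp => (Finset.mem_filter.1 hp).1
  let k : Fin J → ℕ := fun j => 2 * (J - 1 - j)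
  let g : ℕ → ℝ := fun p => ((Ω p).card / p : ℝ)
  have hdisj : ∀ i j, i ≠ j → Disjoint (Q i) (Q j) := by
    intro i j hij
    rw [Finset.disjoint_left]
    intro p hi hj
    have hi := (Finset.mem_filter.1 hi).2
    have hj := (Finset.mem_filter.1 hj).2
    rcases lt_or_gt_of_ne (fun h => hij (Fin.ext h) : (i : ℕ) ≠ j) with h | h
    · have := dexp_mono (show (i : ℕ) + 1 ≤ j by omega); omega
    · have := dexp_mono (show (j : ℕ) + 1 ≤ i by omega); omega
  have hPQ : P = Finset.univ.biUnion Q := by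
    ext p
    simp only [Finset.mem_biUnion, Finset.mem_univ, true_and]
    refine ⟨fun hp => ?_, fun ⟨j, hj⟩ => hQ j p hj⟩
    obtain ⟨j, hj, h⟩ := exists_dexp_lt_le (hP p hp).2.1 (hP p hp).2.2
    exact ⟨⟨j, hj⟩, Finset.mem_filter.2 ⟨hp, h⟩⟩
  have hg : ∀ p ∈ P, 0 ≤ g p ∧ g p ≤ 2 / 3 := fun p hp => by
    refine ⟨div_nonneg (Nat.cast_nonneg _) (Nat.cast_nonneg _), ?_⟩
    have h1 : ((Ω p).card : ℝ) ≤ 2 := by exact_mod_cast (hΩ p hp).2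
    have h2 : (3 : ℝ) ≤ p := by exact_mod_cast (hP p hp).2.1
    simp only [g]
    gcongr
  -- the sifted set is bounded by the sum of the truncated products
  have hstep1 : (((Finset.Ioc 0 N).filter fun m => ∀ p ∈ P, m % p ∉ Ω p).card : ℝ) ≤
      ∑ m ∈ Finset.Ioc 0 N,
        ∏ j, truncProd (fun p => if m % p ∈ Ω p then (1 : ℝ) else 0) (Q j) (k j) := by
    rw [Finset.card_filter]
    push_cast
    refine Finset.sum_le_sum fun m _ => ?_
    have h1 : ∀ j, ∏ p ∈ Q j, (1 - if m % p ∈ Ω p then (1 : ℝ) else 0) ≤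
        truncProd (fun p => if m % p ∈ Ω p then (1 : ℝ) else 0) (Q j) (k j) := fun j => by
      have := (bonferroni (g := fun p => if m % p ∈ Ω p then (1 : ℝ) else 0) (P := Q j)
        (fun p _ => by split_ifs <;> norm_num) (k j)).1
      rw [(even_two_mul _).neg_one_pow, one_mul] at this
      linarith
    have h0 : ∀ j, 0 ≤ ∏ p ∈ Q j, (1 - if m % p ∈ Ω p then (1 : ℝ) else 0) := fun j =>
      Finset.prod_nonneg fun p _ => by split_ifs <;> norm_num
    refine le_trans ?_ (Finset.prod_le_prod (fun j _ => h0 j) (fun j _ => h1 j))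
    split_ifs with h
    · refine le_of_eq (Eq.symm ?_)
      refine Finset.prod_eq_one fun j _ => Finset.prod_eq_one fun p hp => ?_
      simp [h p (hQ j p hp)]
    · exact Finset.prod_nonneg fun j _ => h0 j
  refine hstep1.trans ((sum_prod_truncProd_le hdisj k (fun j p hp => (hP p (hQ j p hp)).1)
    (fun j p hp => (hΩ p (hQ j p hp)).1) N).trans ?_)
  refine add_le_add ?_ ?_
  · have hS : ∀ j, ∑ p ∈ Q j, g p ≤ 8 := fun j => by
      calc ∑ p ∈ Q j, g p ≤ 2 * primeRecipSum (fun _ => True) (dexp j) (dexp (j + 1)) := by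
            rw [primeRecipSum, Finset.mul_sum]
            refine (Finset.sum_le_sum (g := fun p : ℕ => 2 * (1 / p : ℝ)) fun p hp => ?_).trans
              (Finset.sum_le_sum_of_subset_of_nonneg ?_ fun p _ _ => by positivity)
            · have h1 : ((Ω p).card : ℝ) ≤ 2 := by exact_mod_cast (hΩ p (hQ j p hp)).2
              simp only [g]
              rw [mul_one_div]
              gcongr
            · intro p hp
              have h1 := Finset.mem_filter.1 hp
              simp only [Finset.mem_filter, Finset.mem_Ioc, and_true]
              exact ⟨h1.2, (hP p h1.1).1⟩
        _ ≤ 8 := by linarith [primeRecipSum_dexp_le j]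
    have h1 : ∀ j, truncProd g (Q j) (k j) ≤ (∏ p ∈ Q j, (1 - g p)) *
        Real.exp (Real.exp 24 * ((8 : ℝ) ^ (k j + 1) / (k j + 1).factorial)) := fun j => by
      have := truncProd_le_prod_mul_exp (fun p hp => hg p (hQ j p hp)) (hS j) (k := k j)
        (even_two_mul _)
      norm_num at this ⊢
      exact this
    have h0 : ∀ j, 0 ≤ truncProd g (Q j) (k j) := fun j => by
      have := (bonferroni (g := g) (P := Q j) (fun p hp => ⟨(hg p (hQ j p hp)).1,
        by linarith [(hg p (hQ j p hp)).2]⟩) (k j)).1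
      rw [(even_two_mul _).neg_one_pow, one_mul] at this
      have h3 : 0 ≤ ∏ p ∈ Q j, (1 - g p) :=
        Finset.prod_nonneg fun p hp => by linarith [(hg p (hQ j p hp)).2]
      linarith
    have h2 : ∏ j, truncProd g (Q j) (k j) ≤
        (∏ p ∈ P, (1 - g p)) * Real.exp (Real.exp 24 * Real.exp 8) := by
      refine (Finset.prod_le_prod (fun j _ => h0 j) (fun j _ => h1 j)).trans ?_
      rw [Finset.prod_mul_distrib, ← Real.exp_sum, ← Finset.mul_sum]
      conv_rhs => rw [hPQ]
      rw [Finset.prod_biUnion fun i _ j _ hij => hdisj i j hij]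
      have h4 : ∑ j : Fin J, (8 : ℝ) ^ (k j + 1) / (k j + 1).factorial ≤ Real.exp 8 := by
        rw [Fin.sum_univ_eq_sum_range (fun j => (8 : ℝ) ^ (2 * (J - 1 - j) + 1) /
          (2 * (J - 1 - j) + 1).factorial) J,
          Finset.sum_range_reflect (fun i => (8 : ℝ) ^ (2 * i + 1) / (2 * i + 1).factorial) J]
        exact (sum_range_odd_le (a := fun i => (8 : ℝ) ^ i / i.factorial)
          (fun i => by positivity) J).trans (Real.sum_le_exp_of_nonneg (by norm_num) _)
      refine mul_le_mul_of_nonneg_left (Real.exp_le_exp.2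
        (mul_le_mul_of_nonneg_left h4 (Real.exp_nonneg _))) ?_
      exact Finset.prod_nonneg fun j _ => Finset.prod_nonneg fun p hp => by
        linarith [(hg p (hQ j p hp)).2]
    calc (N : ℝ) * ∏ j, truncProd g (Q j) (k j)
        ≤ N * ((∏ p ∈ P, (1 - g p)) * Real.exp (Real.exp 24 * Real.exp 8)) :=
          mul_le_mul_of_nonneg_left h2 (Nat.cast_nonneg N)
      _ = _ := by ring
  · calc ∏ j, ∑ s ∈ (Q j).powerset with s.card ≤ k j, ∏ p ∈ s, ((Ω p).card : ℝ)
        ≤ ∏ j : Fin J, ((2 : ℝ) ^ (8 * (2 ^ (j : ℕ) * (J - 1 - j)))) := by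
          refine Finset.prod_le_prod (fun j _ => Finset.sum_nonneg fun s _ =>
            Finset.prod_nonneg fun p _ => Nat.cast_nonneg _) fun j _ => ?_
          refine (sum_powerset_card_le (fun p hp => (hΩ p (hQ j p hp)).2) _).trans ?_
          have h1 : (Q j).card ≤ dexp (j + 1) := by
            refine (Finset.card_le_card (t := Finset.Ioc 0 (dexp (j + 1))) fun p hp => ?_).trans
              (by simp)
            have := Finset.mem_filter.1 hp
            exact Finset.mem_Ioc.2 ⟨by omega, this.2.2⟩
          have h2 : 4 ≤ dexp (j + 1) := dexp_mono (show 1 ≤ (j : ℕ) + 1 by omega)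
          have h3 : 1 + 2 * (Q j).card ≤ dexp (j + 1) ^ 2 := by nlinarith
          have h4 : (1 + 2 * (Q j).card : ℝ) ≤ (2 : ℝ) ^ (2 ^ ((j : ℕ) + 1) * 2) := by
            rw [pow_mul]
            exact_mod_cast h3
          calc (1 + 2 * (Q j).card : ℝ) ^ k j ≤ ((2 : ℝ) ^ (2 ^ ((j : ℕ) + 1) * 2)) ^ k j :=
                pow_le_pow_left₀ (by linarith [Nat.cast_nonneg (α := ℝ) (Q j).card]) h4 _
            _ = _ := by
                rw [← pow_mul]
                congr 1
                simp only [k]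
                ring
      _ = (2 : ℝ) ^ (8 * ∑ j ∈ Finset.range J, 2 ^ j * (J - 1 - j)) := by
          rw [Finset.prod_pow_eq_pow_sum, Finset.mul_sum,
            Fin.sum_univ_eq_sum_range (fun j => 8 * (2 ^ j * (J - 1 - j))) J]
      _ ≤ (2 : ℝ) ^ (2 ^ J * 8) := by
          refine pow_le_pow_right₀ (by norm_num) ?_
          have := sum_two_pow_mul_sub_le J
          omega
      _ = (dexp J : ℝ) ^ 8 := by rw [pow_mul, dexp]; push_cast; rfl

/-- The prime `q` divides `p - 1` for some `q` in the window `(dexp i, dexp (i + κ)]`. -/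
def HasWindowFactor (i κ p : ℕ) : Prop :=
  ∃ q, q.Prime ∧ dexp i < q ∧ q ≤ dexp (i + κ) ∧ q ∣ p - 1

lemma prod_one_sub_inv_le_exp (G : ℕ → Prop) (a b : ℕ) :
    ∏ p ∈ Finset.Ioc a b with p.Prime ∧ G p, (1 - 1 / p : ℝ) ≤
      Real.exp (-primeRecipSum G a b) := by
  rw [primeRecipSum, ← Finset.sum_neg_distrib, Real.exp_sum]
  refine Finset.prod_le_prod (fun p hp => ?_) fun p hp => ?_
  · have : (1 : ℝ) ≤ p := by exact_mod_cast (Finset.mem_filter.1 hp).2.1.one_le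
    rw [sub_nonneg, div_le_one (by linarith)]
    exact this
  · linarith [Real.add_one_le_exp (-(1 / p : ℝ))]

lemma sum_le_primeRecipSum_dexp {G : ℕ → Prop} {c : ℝ} {i : ℕ}
    (hG : ∀ j ≥ i, c ≤ primeRecipSum G (dexp j) (dexp (j + 1))) (κ : ℕ) :
    κ * c ≤ primeRecipSum G (dexp i) (dexp (i + κ)) := by
  have h1 := sum_range_primeRecipSum G (u := fun t => dexp (i + t))
    (fun a b h => dexp_mono (by omega)) κ
  simp only [add_zero] at h1
  rw [← h1, ← nsmul_eq_mul]
  conv_lhs => rw [← Finset.card_range κ]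
  exact Finset.card_nsmul_le_sum _ _ _ fun t _ => hG (i + t) (by omega)

lemma prod_window_sieve_le {i κ J : ℕ} (hJ : i + κ ≤ J) {c : ℝ}
    (hi : c ≤ primeRecipSum (fun _ => True) (dexp i) (dexp (i + κ))) :
    ∏ p ∈ Finset.Ioc 2 (dexp J) with p.Prime,
      (1 - ((if dexp i < p ∧ p ≤ dexp (i + κ) then {0, 1} else {0} : Finset ℕ).card : ℝ) / p) ≤
      4 / 2 ^ J * Real.exp (-c) := by
  have h2i : 2 ≤ dexp i := dexp_zero ▸ dexp_mono (Nat.zero_le i)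
  have hp2 : ∀ p ∈ (Finset.Ioc 2 (dexp J)).filter Nat.Prime, (3 : ℝ) ≤ p := fun p hp => by
    exact_mod_cast (Finset.mem_Ioc.1 (Finset.mem_filter.1 hp).1).1
  have hinv : ∀ p ∈ (Finset.Ioc 2 (dexp J)).filter Nat.Prime, (1 / p : ℝ) ≤ 1 / 3 ∧
      0 ≤ (1 / p : ℝ) := fun p hp =>
    ⟨one_div_le_one_div_of_le (by norm_num) (hp2 p hp), by positivity⟩
  calc _ ≤ ∏ p ∈ Finset.Ioc 2 (dexp J) with p.Prime,
        ((1 - 1 / p : ℝ) * if dexp i < p ∧ p ≤ dexp (i + κ) then (1 - 1 / p : ℝ) else 1) := by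
        refine Finset.prod_le_prod (fun p hp => ?_) fun p hp => ?_
        · obtain ⟨h1, h2⟩ := hinv p hp
          split_ifs
          · rw [Finset.card_pair zero_ne_one, div_eq_mul_one_div]
            push_cast
            linarith
          · rw [Finset.card_singleton]
            push_cast
            linarith
        · obtain ⟨h1, h2⟩ := hinv p hp
          split_ifs
          · rw [Finset.card_pair zero_ne_one, div_eq_mul_one_div]
            push_cast
            nlinarith
          · rw [Finset.card_singleton]
            push_cast
            linarith
    _ = (∏ p ∈ Finset.Ioc 2 (dexp J) with p.Prime, (1 - 1 / p : ℝ)) *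
        ∏ p ∈ Finset.Ioc (dexp i) (dexp (i + κ)) with p.Prime ∧ True, (1 - 1 / p : ℝ) := by
        rw [Finset.prod_mul_distrib, ← Finset.prod_filter]
        congr 2
        have := dexp_mono hJ
        ext p
        simp only [Finset.mem_filter, Finset.mem_Ioc]
        constructor
        · rintro ⟨⟨-, h1⟩, h2⟩; exact ⟨h2, h1, trivial⟩
        · rintro ⟨h1, h2, -⟩; exact ⟨⟨⟨by omega, by omega⟩, h2⟩, h1⟩
    _ ≤ 4 / 2 ^ J * Real.exp (-c) := by
        have hW := (prod_one_sub_inv_le_exp _ _ _).trans (Real.exp_le_exp.2 (neg_le_neg hi))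
        refine mul_le_mul (prod_one_sub_inv_le J) (by convert hW)
          (Finset.prod_nonneg fun p hp => ?_) (by positivity)
        have : (1 : ℝ) ≤ p := by exact_mod_cast (Finset.mem_filter.1 hp).2.1.one_le
        rw [sub_nonneg, div_le_one (by linarith)]
        exact this

lemma card_not_hasWindowFactor_le : ∃ C : ℝ, 0 < C ∧ ∀ (i κ J l : ℕ) (c : ℝ), i + κ ≤ J →
    2 ^ J ≤ l → c ≤ primeRecipSum (fun _ => True) (dexp i) (dexp (i + κ)) →
    (((Finset.Ioc (2 ^ l) (2 ^ (l + 1))).filter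
      fun p => p.Prime ∧ ¬ HasWindowFactor i κ p).card : ℝ) ≤
      C * 2 ^ l * (Real.exp (-c) / 2 ^ J) + (dexp J : ℝ) ^ 8 := by
  obtain ⟨C, hC, hs⟩ := brun_hooley_sieve
  refine ⟨8 * C, by positivity, fun i κ J l c hJ hl hc => ?_⟩
  let P : Finset ℕ := (Finset.Ioc 2 (dexp J)).filter Nat.Prime
  let Ω : ℕ → Finset ℕ := fun p => if dexp i < p ∧ p ≤ dexp (i + κ) then {0, 1} else {0}
  have h1 := hs J (2 ^ (l + 1)) P Ω (fun p hp => by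
      have := Finset.mem_filter.1 hp
      have h2 := Finset.mem_Ioc.1 this.1
      exact ⟨this.2, h2⟩) (fun p hp => by
      have h2 := (Finset.mem_filter.1 hp).2.two_le
      simp only [Ω]
      split_ifs
      · refine ⟨fun x hx => ?_, (Finset.card_pair zero_ne_one).le⟩
        simp only [Finset.mem_insert, Finset.mem_singleton] at hx
        rw [Finset.mem_range]
        omega
      · refine ⟨fun x hx => ?_, by simp⟩
        simp only [Finset.mem_singleton] at hx
        rw [Finset.mem_range]
        omega)
  have hdl : dexp J ≤ 2 ^ l := Nat.pow_le_pow_right two_pos hl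
  calc (((Finset.Ioc (2 ^ l) (2 ^ (l + 1))).filter
      fun p => p.Prime ∧ ¬ HasWindowFactor i κ p).card : ℝ)
      ≤ (((Finset.Ioc 0 (2 ^ (l + 1))).filter fun m => ∀ p ∈ P, m % p ∉ Ω p).card : ℝ) := by
        norm_cast
        refine Finset.card_le_card fun p hp => ?_
        obtain ⟨hp1, hp2, hp3⟩ := Finset.mem_filter.1 hp
        rw [Finset.mem_Ioc] at hp1
        refine Finset.mem_filter.2 ⟨Finset.mem_Ioc.2 ⟨by omega, hp1.2⟩, fun q hq => ?_⟩
        obtain ⟨hq1, hq2⟩ := Finset.mem_filter.1 hq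
        rw [Finset.mem_Ioc] at hq1
        have h0 : p % q ≠ 0 := fun h => by
          have := (Nat.prime_dvd_prime_iff_eq hq2 hp2).1 (Nat.dvd_of_mod_eq_zero h)
          omega
        simp only [Ω]
        split_ifs with hw
        · simp only [Finset.mem_insert, Finset.mem_singleton, not_or]
          refine ⟨h0, fun h => hp3 ⟨q, hq2, hw.1, hw.2, ?_⟩⟩
          rw [← h]
          exact Nat.dvd_sub_mod p
        · simpa using h0
    _ ≤ _ := h1
    _ ≤ C * (2 ^ (l + 1) : ℕ) * (4 / 2 ^ J * Real.exp (-c)) + (dexp J : ℝ) ^ 8 := by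
        have := prod_window_sieve_le hJ hc
        exact add_le_add (mul_le_mul_of_nonneg_left this (by positivity)) le_rfl
    _ = _ := by push_cast; ring

lemma primeRecipSum_not_hasWindowFactor_le : ∃ C : ℝ, 0 < C ∧ ∀ (i κ J : ℕ) (c : ℝ),
    i + κ ≤ J → c ≤ primeRecipSum (fun _ => True) (dexp i) (dexp (i + κ)) →
    primeRecipSum (fun p => ¬ HasWindowFactor i κ p) (dexp (J + 5)) (dexp (J + 6)) ≤
      C * Real.exp (-c) + 1 / 256 := by
  obtain ⟨C, hC, hs⟩ := card_not_hasWindowFactor_le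
  refine ⟨32 * C, by positivity, fun i κ J c hJ hc => ?_⟩
  have h1 := sum_range_primeRecipSum (fun p => ¬ HasWindowFactor i κ p)
    (u := fun t => 2 ^ (2 ^ (J + 5) + t))
    (fun a b h => Nat.pow_le_pow_right two_pos (by omega)) (2 ^ (J + 5))
  have h2 : (2 : ℕ) ^ (2 ^ (J + 5) + 2 ^ (J + 5)) = dexp (J + 6) := by rw [dexp]; ring_nf
  simp only [add_zero, h2] at h1
  have hterm : ∀ t, primeRecipSum (fun p => ¬ HasWindowFactor i κ p) (2 ^ (2 ^ (J + 5) + t))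
      (2 ^ (2 ^ (J + 5) + (t + 1))) ≤
      C * (Real.exp (-c) / 2 ^ J) + 2 ^ (2 ^ J * 8) / 2 ^ (2 ^ J * 32) := fun t => by
    set l := 2 ^ (J + 5) + t with hl
    have hJl : 2 ^ J ≤ l := by
      have : 2 ^ J ≤ 2 ^ (J + 5) := Nat.pow_le_pow_right two_pos (by omega)
      omega
    refine (primeRecipSum_le_card _ (by positivity)).trans ?_
    have h3 := hs i κ J l c hJ hJl hc
    rw [← add_assoc, ← hl]
    push_cast
    have h4 : (0 : ℝ) < 2 ^ l := by positivity
    rw [div_le_iff₀ h4]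
    refine (le_of_eq (by congr!)).trans (h3.trans ?_)
    have h5 : (2 : ℝ) ^ (2 ^ J * 32) ≤ 2 ^ l :=
      pow_le_pow_right₀ (by norm_num) (by rw [hl, pow_add]; omega)
    have h6 : (2 : ℝ) ^ (2 ^ J * 8) ≤ 2 ^ (2 ^ J * 8) / 2 ^ (2 ^ J * 32) * 2 ^ l := by
      rw [div_mul_eq_mul_div, le_div_iff₀ (by positivity)]
      exact mul_le_mul_of_nonneg_left h5 (by positivity)
    have h7 : (dexp J : ℝ) ^ 8 = 2 ^ (2 ^ J * 8) := by rw [pow_mul, dexp]; push_cast; rfl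
    rw [h7, add_mul]
    refine add_le_add (le_of_eq (by ring)) h6
  have h8 : (2 : ℝ) ^ (J + 5) * (2 ^ (2 ^ J * 8) / 2 ^ (2 ^ J * 32)) ≤ 1 / 256 := by
    rw [← mul_div_assoc, div_le_div_iff₀ (by positivity) (by norm_num), one_mul,
      show (256 : ℝ) = 2 ^ 8 by norm_num, ← pow_add, ← pow_add]
    refine pow_le_pow_right₀ (by norm_num) ?_
    have : J < 2 ^ J := Nat.lt_two_pow_self
    omega
  rw [dexp, ← h1]
  calc _ ≤ ∑ t ∈ Finset.range (2 ^ (J + 5)),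
        (C * (Real.exp (-c) / 2 ^ J) + 2 ^ (2 ^ J * 8) / 2 ^ (2 ^ J * 32)) :=
        Finset.sum_le_sum fun t _ => hterm t
    _ = C * 32 * Real.exp (-c) + 2 ^ (J + 5) * (2 ^ (2 ^ J * 8) / 2 ^ (2 ^ J * 32)) := by
        rw [Finset.sum_const, Finset.card_range, nsmul_eq_mul]
        push_cast
        field_simp
        ring
    _ ≤ _ := by linarith

/-- Most primes `p` have a prime factor of `p - 1` in a long enough window. -/
theorem exists_le_primeRecipSum_hasWindowFactor : ∃ κ j₀ : ℕ, ∀ i ≥ j₀, ∀ J ≥ i + κ,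
    1 / 64 ≤ primeRecipSum (HasWindowFactor i κ) (dexp (J + 5)) (dexp (J + 6)) := by
  obtain ⟨C, hC, hs⟩ := primeRecipSum_not_hasWindowFactor_le
  obtain ⟨j₀, hj₀⟩ := eventually_atTop.1 eventually_le_primeRecipSum_dexp
  have h1 : Tendsto (fun κ : ℕ => C * Real.exp (-(κ * (1 / 32)))) atTop (nhds (C * 0)) :=
    ((Real.tendsto_exp_neg_atTop_nhds_zero).comp
      (tendsto_natCast_atTop_atTop.atTop_mul_const (by norm_num))).const_mul C
  rw [mul_zero] at h1
  obtain ⟨κ, hκ⟩ := (h1.eventually (gt_mem_nhds (show (0 : ℝ) < 1 / 256 by norm_num))).exists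
  refine ⟨κ, j₀, fun i hi J hJ => ?_⟩
  have h2 := hs i κ J (κ * (1 / 32)) hJ
    (sum_le_primeRecipSum_dexp (fun j hj => hj₀ j (hi.le.trans hj)) κ)
  have h3 := primeRecipSum_add_not (HasWindowFactor i κ) (dexp (J + 5)) (dexp (J + 6))
  have h4 := hj₀ (J + 5) (by omega)
  linarith

open ArithmeticFunction.vonMangoldt in
/-- The sum of the reciprocals of the primes in an invertible residue class diverges. -/
theorem not_summable_one_div_prime_residueClass {q : ℕ} [NeZero q] {a : ZMod q} (ha : IsUnit a) :
    ¬ Summable fun n : ℕ => if n.Prime ∧ (n : ZMod q) = a then (1 / n : ℝ) else 0 := by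
  intro H
  have hb := H.add (summable_residueClass_non_primes_div a)
  obtain ⟨C, hC⟩ := LSeries_residueClass_lower_bound ha
  have hq : 0 < (q.totient : ℝ)⁻¹ := inv_pos.2 (by exact_mod_cast q.totient.pos_of_neZero)
  have hIoc : Set.Ioc (1 : ℝ) 2 ∈ nhdsWithin (1 : ℝ) (Set.Ioi 1) :=
    Ioc_mem_nhdsGT (by norm_num)
  have hsub : Tendsto (fun x : ℝ => x - 1) (nhdsWithin 1 (Set.Ioi 1)) (nhds 0) := by
    have : Tendsto (fun x : ℝ => x - 1) (nhds 1) (nhds (1 - 1)) := tendsto_id.sub_const 1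
    rw [sub_self] at this
    exact this.mono_left nhdsWithin_le_nhds
  have hterm : ∀ x ∈ Set.Ioc (1 : ℝ) 2, ∀ n : ℕ, 0 ≤ (x - 1) * (residueClass a n / (n : ℝ) ^ x) ∧
      (x - 1) * (residueClass a n / (n : ℝ) ^ x) ≤
      (if n.Prime ∧ (n : ZMod q) = a then (1 / n : ℝ) else 0) +
        (if n.Prime then 0 else residueClass a n) / n := by
    intro x hx n
    have hx1 : 0 < x - 1 := by linarith [hx.1]
    have hr := residueClass_nonneg a n
    refine ⟨mul_nonneg hx1.le (div_nonneg hr (Real.rpow_nonneg (Nat.cast_nonneg n) _)), ?_⟩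
    rcases n.eq_zero_or_pos with rfl | hn
    · simp
    have hn' : (1 : ℝ) ≤ n := by exact_mod_cast hn
    have hpow : (n : ℝ) ≤ (n : ℝ) ^ x := by
      conv_lhs => rw [← Real.rpow_one (n : ℝ)]
      exact Real.rpow_le_rpow_of_exponent_le hn' hx.1.le
    by_cases hp : n.Prime
    · by_cases hna : (n : ZMod q) = a
      · simp only [hp, hna, and_self, if_true, zero_div, add_zero]
        have h1 : residueClass a n = Real.log n := by
          rw [residueClass, Set.indicator_of_mem (show n ∈ {n : ℕ | (n : ZMod q) = a} from hna),
            ArithmeticFunction.vonMangoldt_apply_prime hp]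
        have h2 : (n : ℝ) ^ x = n * Real.exp ((x - 1) * Real.log n) := by
          rw [show x = 1 + (x - 1) by ring, Real.rpow_add (by linarith), Real.rpow_one,
            Real.rpow_def_of_pos (by linarith)]
          ring_nf
        have h3 := Real.add_one_le_exp ((x - 1) * Real.log n)
        rw [h1, h2, ← mul_div_assoc, div_le_div_iff₀ (by positivity) (by linarith)]
        nlinarith
      · simp [hp, hna]
    · simp only [hp, false_and, if_false, zero_add]
      calc (x - 1) * (residueClass a n / (n : ℝ) ^ x) ≤ 1 * (residueClass a n / (n : ℝ) ^ x) :=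
            mul_le_mul_of_nonneg_right (by linarith [hx.2]) (by positivity)
        _ ≤ residueClass a n / n := by
            rw [one_mul]
            exact div_le_div_of_nonneg_left hr (by linarith) hpow
  have hlim : Tendsto (fun x : ℝ => ∑' n : ℕ, (x - 1) * (residueClass a n / (n : ℝ) ^ x))
      (nhdsWithin 1 (Set.Ioi 1)) (nhds (∑' _ : ℕ, (0 : ℝ))) := by
    refine tendsto_tsum_of_dominated_convergence hb (fun n => ?_) ?_
    · have hbd : ∀ᶠ x : ℝ in nhdsWithin 1 (Set.Ioi 1),
          (x - 1) * (residueClass a n / (n : ℝ) ^ x) ≤ (x - 1) * residueClass a n := by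
        filter_upwards [hIoc] with x hx
        refine mul_le_mul_of_nonneg_left ?_ (by linarith [hx.1])
        rcases n.eq_zero_or_pos with rfl | hn
        · simp
        · exact div_le_self (residueClass_nonneg a n)
            (Real.one_le_rpow (by exact_mod_cast hn) (by linarith [hx.1]))
      refine tendsto_of_tendsto_of_tendsto_of_le_of_le' tendsto_const_nhds
        (by simpa using hsub.mul_const (residueClass a n)) ?_ hbd
      filter_upwards [hIoc] with x hx using (hterm x hx n).1
    · filter_upwards [hIoc] with x hx n
      rw [Real.norm_of_nonneg (hterm x hx n).1]
      exact (hterm x hx n).2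
  rw [tsum_zero] at hlim
  have hlow : Tendsto (fun x : ℝ => (q.totient : ℝ)⁻¹ - (x - 1) * C)
      (nhdsWithin 1 (Set.Ioi 1)) (nhds ((q.totient : ℝ)⁻¹ - 0 * C)) :=
    tendsto_const_nhds.sub (hsub.mul_const C)
  rw [zero_mul, sub_zero] at hlow
  refine absurd (le_of_tendsto_of_tendsto hlow hlim ?_) (not_le.2 hq)
  filter_upwards [hIoc] with x hx
  have hx1 : 0 < x - 1 := by linarith [hx.1]
  have h1 := mul_le_mul_of_nonneg_left (hC hx) hx1.le
  rw [tsum_mul_left]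
  rwa [mul_sub, mul_div_cancel₀ _ hx1.ne'] at h1

lemma tendsto_primeRecipSum_residueClass {L : ℕ} (hL : 0 < L) :
    Tendsto (fun J => primeRecipSum (fun p => L ∣ p - 1) 2 (dexp J)) atTop atTop := by
  have : NeZero L := ⟨hL.ne'⟩
  have h1 := (not_summable_iff_tendsto_nat_atTop_of_nonneg (fun n => by positivity)).1
    (not_summable_one_div_prime_residueClass (q := L) (a := 1) isUnit_one)
  have hd : Tendsto (fun J => dexp J + 1) atTop atTop := by
    refine tendsto_atTop_mono (fun J => ?_) tendsto_id
    have h2 : J < 2 ^ J := Nat.lt_two_pow_self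
    have h3 : 2 ^ J < 2 ^ 2 ^ J := Nat.lt_two_pow_self
    simp only [id, dexp]
    omega
  have h2 := tendsto_atTop_add_const_right _ (-(3 : ℝ)) (h1.comp hd)
  refine tendsto_atTop_mono (fun J => ?_) h2
  simp only [Function.comp]
  have h2J : 2 ≤ dexp J := dexp_zero ▸ dexp_mono (Nat.zero_le J)
  rw [primeRecipSum_eq, ← Finset.sum_range_add_sum_Ico _ (show 3 ≤ dexp J + 1 by omega)]
  refine (add_le_add (add_le_add (?_ : _ ≤ (3 : ℝ)) ?_) le_rfl).trans
    ((add_comm _ _).trans (neg_add_cancel_left _ _)).le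
  · refine (Finset.sum_le_card_nsmul _ _ 1 fun n _ => ?_).trans (by norm_num)
    split_ifs with h
    · have : (1 : ℝ) ≤ n := by exact_mod_cast h.1.one_le
      rw [div_le_one (by linarith)]
      exact this
    · exact zero_le_one
  · refine le_of_eq (Finset.sum_congr ?_ fun n hn => ?_)
    · ext n
      simp only [Finset.mem_Ico, Finset.mem_Ioc]
      omega
    · have h5 : 1 ≤ n := by
        have := Finset.mem_Ioc.1 hn
        omega
      have h6 : (n : ZMod L) = 1 ↔ L ∣ n - 1 := by
        rw [← ZMod.natCast_eq_zero_iff, Nat.cast_sub h5, Nat.cast_one, sub_eq_zero]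
      simp only [h6]
      congr

/-- `n` is divisible by a prime `p ∈ (a, b]` satisfying `G`. -/
def HasPrimeDivisorIn (G : ℕ → Prop) (a b n : ℕ) : Prop :=
  ∃ p, p.Prime ∧ G p ∧ a < p ∧ p ≤ b ∧ p ∣ n

lemma card_not_hasPrimeDivisorIn_le : ∃ C : ℝ, 0 < C ∧ ∀ (G : ℕ → Prop) (a b J N : ℕ),
    2 ≤ a → b ≤ dexp J →
    (((Finset.Ioc 0 N).filter fun n => ¬ HasPrimeDivisorIn G a b n).card : ℝ) ≤
      C * N * Real.exp (-primeRecipSum G a b) + (dexp J : ℝ) ^ 8 := by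
  obtain ⟨C, hC, hs⟩ := brun_hooley_sieve
  refine ⟨C, hC, fun G a b J N ha hb => ?_⟩
  have h1 := hs J N ((Finset.Ioc a b).filter fun p => p.Prime ∧ G p) (fun _ => {0})
    (fun p hp => by
      obtain ⟨hp1, hp2, -⟩ := Finset.mem_filter.1 hp
      rw [Finset.mem_Ioc] at hp1
      exact ⟨hp2, by omega, by omega⟩)
    (fun p hp => by
      have := (Finset.mem_filter.1 hp).2.1.pos
      exact ⟨fun x hx => by rw [Finset.mem_singleton] at hx; rw [Finset.mem_range]; omega,
        by simp⟩)
  refine le_trans ?_ (h1.trans (add_le_add (mul_le_mul_of_nonneg_left ?_ (by positivity)) le_rfl))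
  · norm_cast
    refine Finset.card_le_card fun n hn => ?_
    obtain ⟨hn1, hn2⟩ := Finset.mem_filter.1 hn
    refine Finset.mem_filter.2 ⟨hn1, fun p hp => ?_⟩
    obtain ⟨hp1, hp2, hp3⟩ := Finset.mem_filter.1 hp
    rw [Finset.mem_Ioc] at hp1
    rw [Finset.mem_singleton]
    exact fun h => hn2 ⟨p, hp2, hp3, hp1.1, hp1.2, Nat.dvd_of_mod_eq_zero h⟩
  · simp only [Finset.card_singleton, Nat.cast_one]
    exact prod_one_sub_inv_le_exp G a b

/-- Two divisors `p, p' ≤ X` of `n`, with `p * p' ∣ n`, are congruent to `1` modulo a common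
`q > w`. -/
def HasCollision (w X n : ℕ) : Prop :=
  ∃ q p p', w < q ∧ 1 < p ∧ p ≤ X ∧ 1 < p' ∧ p' ≤ X ∧ q ∣ p - 1 ∧ q ∣ p' - 1 ∧ p * p' ∣ n

lemma card_filter_dvd_le (N d : ℕ) :
    (((Finset.Ioc 0 N).filter fun n => d ∣ n).card : ℝ) ≤ N / d := by
  rw [Nat.Ioc_filter_dvd_card_eq_div]
  exact Nat.cast_div_le

lemma sum_one_div_le_one_add_log (X : ℕ) :
    ∑ a ∈ Finset.Ioc 0 X, (1 / a : ℝ) ≤ 1 + Real.log X := by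
  have h := harmonic_le_one_add_log X
  rw [harmonic_eq_sum_Icc] at h
  push_cast at h
  rw [show Finset.Ioc 0 X = Finset.Icc 1 X by ext; simp [Finset.mem_Ioc, Nat.succ_le_iff]]
  simpa [one_div] using h

lemma card_hasCollision_le {w : ℕ} (hw : 0 < w) (X N : ℕ) :
    (((Finset.Ioc 0 N).filter fun n => HasCollision w X n).card : ℝ) ≤
      N * (1 + Real.log X) ^ 2 / w := by
  let A := Finset.Ioc w X ×ˢ Finset.Ioc 0 X ×ˢ Finset.Ioc 0 X
  have hsub : ((Finset.Ioc 0 N).filter fun n => HasCollision w X n) ⊆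
      A.biUnion fun t => (Finset.Ioc 0 N).filter fun n =>
        (t.1 * t.2.1 + 1) * (t.1 * t.2.2 + 1) ∣ n := by
    intro n hn
    obtain ⟨hn1, q, p, p', hq, hp, hpX, hp', hpX', ⟨a, ha⟩, ⟨a', ha'⟩, hd⟩ :=
      Finset.mem_filter.1 hn
    have hq0 : 0 < q := by omega
    have ha0 : 0 < a := Nat.pos_of_ne_zero fun h => by rw [h, mul_zero] at ha; omega
    have ha0' : 0 < a' := Nat.pos_of_ne_zero fun h => by rw [h, mul_zero] at ha'; omega
    have h1 : a ≤ q * a := Nat.le_mul_of_pos_left a hq0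
    have h2 : q ≤ q * a := Nat.le_mul_of_pos_right q ha0
    have h3 : a' ≤ q * a' := Nat.le_mul_of_pos_left a' hq0
    refine Finset.mem_biUnion.2 ⟨(q, a, a'), ?_, Finset.mem_filter.2 ⟨hn1, ?_⟩⟩
    · simp only [A, Finset.mem_product, Finset.mem_Ioc]
      omega
    · simp only
      rwa [← ha, ← ha', Nat.sub_add_cancel hp.le, Nat.sub_add_cancel hp'.le]
  have hH : 0 ≤ ∑ a ∈ Finset.Ioc 0 X, (1 / a : ℝ) := Finset.sum_nonneg fun a _ => by positivity
  have hsq : ∑ q ∈ Finset.Ioc w X, ((q : ℝ) ^ 2)⁻¹ ≤ 1 / w := by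
    by_cases h : w ≤ X
    · refine (sum_Ioc_inv_sq_le_sub hw.ne' h).trans ?_
      rw [one_div]
      have : (0 : ℝ) ≤ (X : ℝ)⁻¹ := by positivity
      linarith
    · rw [Finset.Ioc_eq_empty_of_le (by omega), Finset.sum_empty]
      positivity
  calc (((Finset.Ioc 0 N).filter fun n => HasCollision w X n).card : ℝ)
      ≤ ∑ t ∈ A, (((Finset.Ioc 0 N).filter fun n =>
        (t.1 * t.2.1 + 1) * (t.1 * t.2.2 + 1) ∣ n).card : ℝ) := by
        exact_mod_cast (Finset.card_le_card hsub).trans Finset.card_biUnion_le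
    _ ≤ ∑ t ∈ A, N * (((t.1 : ℝ) ^ 2)⁻¹ * ((1 / t.2.1) * (1 / t.2.2))) := by
        refine Finset.sum_le_sum fun t ht => (card_filter_dvd_le _ _).trans ?_
        simp only [A, Finset.mem_product, Finset.mem_Ioc] at ht
        have h1 : (0 : ℝ) < t.1 := by exact_mod_cast (show 0 < t.1 by omega)
        have h2 : (0 : ℝ) < t.2.1 := by exact_mod_cast ht.2.1.1
        have h3 : (0 : ℝ) < t.2.2 := by exact_mod_cast ht.2.2.1
        rw [← one_div, one_div_mul_one_div, one_div_mul_one_div, mul_one_div]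
        push_cast
        refine div_le_div_of_nonneg_left (by positivity) (by positivity) ?_
        nlinarith [mul_pos h1 h2, mul_pos h1 h3]
    _ = N * ((∑ q ∈ Finset.Ioc w X, ((q : ℝ) ^ 2)⁻¹) *
        ((∑ a ∈ Finset.Ioc 0 X, (1 / a : ℝ)) * ∑ a ∈ Finset.Ioc 0 X, (1 / a : ℝ))) := by
        rw [← Finset.mul_sum, Finset.sum_mul_sum, ← Finset.sum_product', Finset.sum_mul_sum,
          ← Finset.sum_product']
    _ ≤ N * ((1 / w) * ((1 + Real.log X) * (1 + Real.log X))) := by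
        have := sum_one_div_le_one_add_log X
        have h2 := mul_le_mul this this hH (hH.trans this)
        exact mul_le_mul_of_nonneg_left (mul_le_mul hsq h2 (mul_nonneg hH hH) (by positivity))
          (Nat.cast_nonneg N)
    _ = _ := by ring

/-- There are `R` distinct primes `q` in the window `(dexp i, dexp (i + κ)]` dividing `p - 1`
for some prime divisor `p` of `n`. -/
def HasWindowPrimes (i κ R n : ℕ) : Prop :=
  ∃ S : Finset ℕ, S.card = R ∧ ∀ q ∈ S, q.Prime ∧ dexp i < q ∧ q ≤ dexp (i + κ) ∧
    ∃ p, p.Prime ∧ p ∣ n ∧ q ∣ p - 1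

lemma hasWindowPrimes_of_forall {i κ R t n : ℕ}
    (hG : ∀ r < R, HasPrimeDivisorIn (HasWindowFactor i κ) (dexp (i + κ + 5 + r * t))
      (dexp (i + κ + 5 + (r + 1) * t)) n)
    (hn : ¬ HasCollision (dexp i) (dexp (i + κ + 5 + R * t)) n) : HasWindowPrimes i κ R n := by
  choose p hp hpG hlt hle hdvd using hG
  choose q hq hqi hqκ hqd using hpG
  have hpX : ∀ r hr, p r hr ≤ dexp (i + κ + 5 + R * t) := fun r hr =>
    (hle r hr).trans (dexp_mono (Nat.add_le_add_left (Nat.mul_le_mul_right t hr) _))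
  have hplt : ∀ r s hr hs, r < s → p r hr < p s hs := fun r s hr hs hrs =>
    (hle r hr).trans_lt (lt_of_le_of_lt
      (dexp_mono (Nat.add_le_add_left (Nat.mul_le_mul_right t hrs) _)) (hlt s hs))
  have hqne : ∀ r s hr hs, r < s → q r hr ≠ q s hs := fun r s hr hs hrs h => by
    refine hn ⟨q r hr, p r hr, p s hs, hqi r hr, (hp r hr).one_lt, hpX r hr, (hp s hs).one_lt,
      hpX s hs, hqd r hr, h ▸ hqd s hs, ?_⟩
    exact Nat.Coprime.mul_dvd_of_dvd_of_dvd
      ((Nat.coprime_primes (hp r hr) (hp s hs)).2 (hplt r s hr hs hrs).ne) (hdvd r hr) (hdvd s hs)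
  refine ⟨Finset.univ.image fun r : Fin R => q r r.2, ?_, fun x hx => ?_⟩
  · rw [Finset.card_image_of_injective, Finset.card_univ, Fintype.card_fin]
    intro r s h
    by_contra hne
    rcases lt_or_gt_of_ne (fun h => hne (Fin.ext h) : (r : ℕ) ≠ s) with h1 | h1
    · exact hqne _ _ _ _ h1 h
    · exact hqne _ _ _ _ h1 h.symm
  · obtain ⟨r, -, rfl⟩ := Finset.mem_image.1 hx
    exact ⟨hq r r.2, hqi r r.2, hqκ r r.2, p r r.2, hp r r.2, hdvd r r.2, hqd r r.2⟩

lemma card_not_hasWindowPrimes_le : ∃ C : ℝ, 0 < C ∧ ∃ κ j₀ : ℕ, ∀ i ≥ j₀, ∀ R t N : ℕ,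
    (((Finset.Ioc 0 N).filter fun n => ¬ HasWindowPrimes i κ R n).card : ℝ) ≤
      R * (C * N * Real.exp (-(t / 64)) + (dexp (i + κ + 5 + R * t) : ℝ) ^ 8) +
      N * (4 * 4 ^ (i + κ + 5 + R * t) / dexp i) := by
  obtain ⟨C, hC, hs⟩ := card_not_hasPrimeDivisorIn_le
  obtain ⟨κ, j₀, hκ⟩ := exists_le_primeRecipSum_hasWindowFactor
  refine ⟨C, hC, κ, j₀, fun i hi R t N => ?_⟩
  set T := i + κ + 5 + R * t with hT
  let a : ℕ → ℕ := fun r => dexp (i + κ + 5 + r * t)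
  have hsub : ((Finset.Ioc 0 N).filter fun n => ¬ HasWindowPrimes i κ R n) ⊆
      ((Finset.range R).biUnion fun r => (Finset.Ioc 0 N).filter fun n =>
        ¬ HasPrimeDivisorIn (HasWindowFactor i κ) (a r) (a (r + 1)) n) ∪
      (Finset.Ioc 0 N).filter fun n => HasCollision (dexp i) (dexp T) n := by
    intro n hn
    obtain ⟨hn1, hn2⟩ := Finset.mem_filter.1 hn
    by_contra hcon
    simp only [Finset.mem_union, Finset.mem_biUnion, Finset.mem_filter, hn1, true_and,
      not_or, not_exists, not_and, not_not, Finset.mem_range] at hcon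
    exact hn2 (hasWindowPrimes_of_forall hcon.1 hcon.2)
  have hgood : ∀ r < R, (((Finset.Ioc 0 N).filter fun n =>
      ¬ HasPrimeDivisorIn (HasWindowFactor i κ) (a r) (a (r + 1)) n).card : ℝ) ≤
      C * N * Real.exp (-(t / 64)) + (dexp T : ℝ) ^ 8 := by
    intro r hr
    refine (hs _ (a r) (a (r + 1)) T N (dexp_zero ▸ dexp_mono (Nat.zero_le _))
      (dexp_mono (Nat.add_le_add_left (Nat.mul_le_mul_right t hr) _))).trans ?_
    refine add_le_add (mul_le_mul_of_nonneg_left (Real.exp_le_exp.2 (neg_le_neg ?_))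
      (by positivity)) le_rfl
    have h1 := sum_le_primeRecipSum_dexp (G := HasWindowFactor i κ) (c := 1 / 64)
      (i := i + κ + 5 + r * t) (fun j hj => by
        have := hκ i hi (j - 5) (by omega)
        rwa [show j - 5 + 5 = j by omega, show j - 5 + 6 = j + 1 by omega] at this) t
    have h2 : i + κ + 5 + (r + 1) * t = i + κ + 5 + r * t + t := by ring
    simp only [a]
    rw [h2]
    linarith
  have hcol : (((Finset.Ioc 0 N).filter fun n => HasCollision (dexp i) (dexp T) n).card : ℝ) ≤
      N * (4 * 4 ^ T / dexp i) := by
    refine (card_hasCollision_le (dexp_pos i) _ N).trans ?_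
    rw [mul_div_assoc]
    have h1 : Real.log (dexp T) ≤ 2 ^ T := by
      rw [dexp]
      push_cast
      rw [Real.log_pow]
      have := Real.log_two_lt_d9
      have h2 : (0 : ℝ) < 2 ^ T := by positivity
      push_cast
      nlinarith
    have h0 : 0 ≤ Real.log (dexp T) := Real.log_nonneg (by exact_mod_cast dexp_pos T)
    have h2 : (1 : ℝ) ≤ 2 ^ T := one_le_pow₀ (by norm_num)
    have h3 : (4 : ℝ) ^ T = 2 ^ T * 2 ^ T := by rw [← mul_pow]; norm_num
    have h4 : (1 + Real.log (dexp T)) ^ 2 ≤ 4 * 4 ^ T := by nlinarith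
    gcongr
  calc (((Finset.Ioc 0 N).filter fun n => ¬ HasWindowPrimes i κ R n).card : ℝ)
      ≤ ∑ r ∈ Finset.range R, (((Finset.Ioc 0 N).filter fun n =>
        ¬ HasPrimeDivisorIn (HasWindowFactor i κ) (a r) (a (r + 1)) n).card : ℝ) +
        ((Finset.Ioc 0 N).filter fun n => HasCollision (dexp i) (dexp T) n).card := by
        exact_mod_cast (Finset.card_le_card hsub).trans ((Finset.card_union_le _ _).trans
          (Nat.add_le_add_right Finset.card_biUnion_le _))
    _ ≤ _ := by
        refine add_le_add ?_ hcol
        refine (Finset.sum_le_card_nsmul _ _ _ fun r hr => hgood r (Finset.mem_range.1 hr)).trans ?_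
        rw [Finset.card_range, nsmul_eq_mul]

/-- Almost every `n` has a prime factor congruent to `1` modulo `L`. -/
lemma eventually_card_not_exists_prime_residueClass_le {L : ℕ} (hL : 0 < L) {ε : ℝ} (hε : 0 < ε) :
    ∀ᶠ N : ℕ in atTop, (((Finset.Ioc 0 N).filter fun n =>
      ¬ ∃ p, p.Prime ∧ p ∣ n ∧ L ∣ p - 1).card : ℝ) ≤ ε * N := by
  obtain ⟨C, hC, hs⟩ := card_not_hasPrimeDivisorIn_le
  have h1 : Tendsto (fun J => C * Real.exp (-primeRecipSum (fun p => L ∣ p - 1) 2 (dexp J)))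
      atTop (nhds (C * 0)) :=
    (Real.tendsto_exp_neg_atTop_nhds_zero.comp (tendsto_primeRecipSum_residueClass hL)).const_mul C
  rw [mul_zero] at h1
  obtain ⟨J, hJ⟩ := (h1.eventually (gt_mem_nhds (half_pos hε))).exists
  filter_upwards [tendsto_natCast_atTop_atTop.eventually_ge_atTop ((dexp J : ℝ) ^ 8 / (ε / 2))]
    with N hN
  rw [div_le_iff₀ (half_pos hε)] at hN
  have h2 := hs (fun p => L ∣ p - 1) 2 (dexp J) J N le_rfl le_rfl
  refine le_trans ?_ (h2.trans ?_)
  · norm_cast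
    refine Finset.card_le_card fun n hn => ?_
    obtain ⟨hn1, hn2⟩ := Finset.mem_filter.1 hn
    exact Finset.mem_filter.2 ⟨hn1, fun ⟨p, hp, hpL, _, _, hd⟩ => hn2 ⟨p, hp, hd, hpL⟩⟩
  · have hN0 : (0 : ℝ) ≤ N := Nat.cast_nonneg N
    nlinarith

/-- Multiplying by a small prime preserves the density of the divisors. -/
lemma exists_dvd_mul_of_le {h F D q : ℕ} (hF : 0 < F) (hq : 0 < q) (hqD : q * F ≤ 2 * D)
    (hD : ∀ y : ℝ, h ≤ y → y * F ≤ 2 * h * D →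
      ∃ d : ℕ, d ∣ D ∧ y < d ∧ (d : ℝ) ≤ (1 + 1 / h) * y)
    {y : ℝ} (hy : h ≤ y) (hyq : y * F ≤ 2 * h * (q * D : ℕ)) :
    ∃ d : ℕ, d ∣ q * D ∧ y < d ∧ (d : ℝ) ≤ (1 + 1 / h) * y := by
  have hF' : (0 : ℝ) < F := by exact_mod_cast hF
  have hq' : (0 : ℝ) < q := by exact_mod_cast hq
  have hqD' : (q * F : ℝ) ≤ 2 * D := by exact_mod_cast hqD
  have hh' : (0 : ℝ) ≤ h := Nat.cast_nonneg h
  by_cases hc : y * F ≤ 2 * h * D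
  · obtain ⟨d, hd, h1, h2⟩ := hD y hy hc
    exact ⟨d, hd.mul_left q, h1, h2⟩
  · push Not at hc
    obtain ⟨d, hd, h1, h2⟩ := hD (y / q) (by
      rw [le_div_iff₀ hq']
      nlinarith) (by
      rw [div_mul_eq_mul_div, div_le_iff₀ hq']
      push_cast at hyq
      linarith)
    refine ⟨q * d, mul_dvd_mul_left q hd, ?_, ?_⟩
    · rw [div_lt_iff₀ hq'] at h1
      push_cast
      linarith
    · rw [← mul_div_assoc, le_div_iff₀ hq'] at h2
      push_cast
      linarith

lemma exists_dvd_factorial {h : ℕ} (hh : 0 < h) {y : ℝ} (hy : h ≤ y) (hy2 : y ≤ 2 * h) :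
    ∃ d : ℕ, d ∣ (2 * h + 1).factorial ∧ y < d ∧ (d : ℝ) ≤ (1 + 1 / h) * y := by
  have hh' : (0 : ℝ) < h := by exact_mod_cast hh
  refine ⟨⌊y⌋₊ + 1, Nat.dvd_factorial (Nat.succ_pos _) ?_, ?_, ?_⟩
  · have : ⌊y⌋₊ ≤ 2 * h := Nat.floor_le_of_le (by exact_mod_cast hy2)
    omega
  · exact_mod_cast Nat.lt_floor_add_one y
  · have h1 := Nat.floor_le (hh'.le.trans hy)
    have h2 : 1 ≤ 1 / h * y := by
      rw [one_div_mul_eq_div, le_div_iff₀ hh']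
      linarith
    push_cast
    linarith

lemma pow_card_le_prod {S : Finset ℕ} {a : ℕ} (hS : ∀ q ∈ S, a ≤ q) : a ^ S.card ≤ ∏ q ∈ S, q :=
  Finset.pow_card_le_prod _ _ _ hS

/-- If `m` has many prime factors in each window, then the divisors of `m` are dense. -/
lemma exists_dvd_of_windows {h m i κ n : ℕ} (hh : 0 < h) (hm : 0 < m)
    (hF : (2 * h + 1).factorial ∣ m)
    (h2 : 2 ^ ((2 * h + 1).factorial * dexp (i + κ)) ∣ m)
    (hFi : (2 * h + 1).factorial ≤ dexp (i + κ))
    (hS : ∀ s < n, ∃ S : Finset ℕ, S.card = 3 * 2 ^ κ ∧ ∀ q ∈ S, q.Prime ∧ dexp (i + s) < q ∧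
      q ≤ dexp (i + s + κ) ∧ q ∣ m) {y : ℝ} (hy : h ≤ y) (hyn : y ≤ dexp (i + n + κ)) :
    ∃ d : ℕ, d ∣ m ∧ y < d ∧ (d : ℝ) ≤ (1 + 1 / h) * y := by
  set F := (2 * h + 1).factorial with hFdef
  have hF0 : 0 < F := Nat.factorial_pos _
  have hF0' : (0 : ℝ) < F := by exact_mod_cast hF0
  have hh' : (1 : ℝ) ≤ h := by exact_mod_cast hh
  let T := m.divisors.filter fun D => F ∣ D ∧ ∀ y : ℝ, h ≤ y → y * F ≤ 2 * h * D →
    ∃ d : ℕ, d ∣ D ∧ y < d ∧ (d : ℝ) ≤ (1 + 1 / h) * y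
  have hFT : F ∈ T := by
    refine Finset.mem_filter.2 ⟨Nat.mem_divisors.2 ⟨hF, hm.ne'⟩, dvd_rfl, fun y hy hyF => ?_⟩
    exact exists_dvd_factorial hh hy (le_of_mul_le_mul_right hyF hF0')
  obtain ⟨D, hDT, hmax⟩ := Finset.exists_max_image T id ⟨F, hFT⟩
  obtain ⟨hDm, hFD, hD⟩ := Finset.mem_filter.1 hDT
  have hDm := (Nat.mem_divisors.1 hDm).1
  have hD0 : 0 < D := Nat.pos_of_dvd_of_pos hDm hm
  have hmul : ∀ q, q.Prime → q * F ≤ 2 * D → ¬ q * D ∣ m := fun q hq hqF hqD => by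
    have h1 : q * D ∈ T := Finset.mem_filter.2 ⟨Nat.mem_divisors.2 ⟨hqD, hm.ne'⟩,
      hFD.mul_left q, fun y hy hyq => exists_dvd_mul_of_le hF0 hq.pos hqF hD hy hyq⟩
    have h3 : q * D ≤ D := hmax _ h1
    have h4 := hq.two_le
    nlinarith
  have hpow : ∀ q a, q.Prime → q * F ≤ 2 * D → q ^ a ∣ m → q ^ a ∣ D := fun q a hq hqF ha => by
    obtain ⟨e, rfl⟩ := hDm
    have h1 : ¬ q ∣ e := fun h => hmul q hq hqF (by
      rw [mul_comm q D]
      exact mul_dvd_mul_left D h)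
    exact (Nat.Coprime.pow_left a ((Nat.Prime.coprime_iff_not_dvd hq).2 h1)).dvd_of_dvd_mul_right
      ha
  have hind : ∀ s ≤ n, F * dexp (i + s + κ) ≤ 2 * D := by
    intro s
    induction s with
    | zero =>
      intro _
      have h1 := Nat.le_of_dvd hD0 (hpow 2 _ Nat.prime_two
        (Nat.mul_le_mul_left 2 (Nat.le_of_dvd hD0 hFD)) h2)
      have h3 : F * dexp (i + κ) < 2 ^ (F * dexp (i + κ)) := Nat.lt_two_pow_self
      rw [add_zero]
      omega
    | succ s ih =>
      intro hs
      have ih := ih (by omega)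
      obtain ⟨S, hcard, hSq⟩ := hS s (by omega)
      have h1 : ∏ q ∈ S, q ∣ D := by
        refine Finset.prod_primes_dvd D (fun q hq => (hSq q hq).1.prime) fun q hq => ?_
        have h3 := hpow q 1 (hSq q hq).1
          ((Nat.mul_le_mul_right F (hSq q hq).2.2.1).trans (by rwa [mul_comm]))
          (by simpa using (hSq q hq).2.2.2)
        simpa using h3
      have h3 : dexp (i + s) ^ (3 * 2 ^ κ) ≤ D :=
        (hcard ▸ pow_card_le_prod fun q hq => (hSq q hq).2.1.le).trans (Nat.le_of_dvd hD0 h1)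
      have h4 : dexp (i + s) ^ (3 * 2 ^ κ) = dexp (i + s + κ) ^ 3 := by
        rw [dexp, dexp, ← pow_mul, ← pow_mul, pow_add 2 (i + s) κ]
        ring_nf
      rw [h4] at h3
      have h5 : F ≤ dexp (i + s + κ) := hFi.trans (dexp_mono (by omega))
      rw [show i + (s + 1) + κ = i + s + κ + 1 by ring, dexp_succ]
      calc F * dexp (i + s + κ) ^ 2 ≤ dexp (i + s + κ) * dexp (i + s + κ) ^ 2 :=
            Nat.mul_le_mul_right _ h5
        _ = dexp (i + s + κ) ^ 3 := by ring
        _ ≤ 2 * D := by omega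
  have hn : (F * dexp (i + n + κ) : ℝ) ≤ 2 * D := by exact_mod_cast hind n le_rfl
  obtain ⟨d, hd, h1, h3⟩ := hD y hy (by
    have hD' : (0 : ℝ) ≤ D := Nat.cast_nonneg D
    nlinarith)
  exact ⟨d, hd.trans hDm, h1, h3⟩

lemma carmichael_pos {n : ℕ} (hn : 0 < n) : 0 < carmichael n := by
  have : NeZero n := ⟨hn.ne'⟩
  exact Monoid.ExponentExists.of_finite.exponent_pos

lemma carmichael_dvd_totient {n : ℕ} (hn : 0 < n) : carmichael n ∣ n.totient := by
  have : NeZero n := ⟨hn.ne'⟩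
  rw [← ZMod.card_units_eq_totient]
  exact Group.exponent_dvd_card

lemma sub_one_dvd_carmichael {p n : ℕ} (hn : 0 < n) (hp : p.Prime) (hpn : p ∣ n) :
    p - 1 ∣ carmichael n := by
  have : NeZero n := ⟨hn.ne'⟩
  have : Fact p.Prime := ⟨hp⟩
  have h1 : Monoid.exponent (ZMod p)ˣ ∣ Monoid.exponent (ZMod n)ˣ :=
    MonoidHom.exponent_dvd (ZMod.unitsMap_surjective hpn)
  rwa [IsCyclic.exponent_eq_card, Nat.card_eq_fintype_card, ZMod.card_units] at h1

lemma DenseDivIn.of_dvd {m n : ℕ} {u : ℝ} {I : Set ℝ} (hm : DenseDivIn m u I) (h : m ∣ n) :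
    DenseDivIn n u I := fun y hy => by
  obtain ⟨d, hd, h1⟩ := hm y hy
  exact ⟨d, hd.trans h, h1⟩

lemma denseDivIn_carmichael {h n i κ s : ℕ} (hh : 0 < h) (hn : 0 < n)
    (hFi : (2 * h + 1).factorial ≤ dexp (i + κ))
    (hL : ∃ p, p.Prime ∧ p ∣ n ∧
      (2 * h + 1).factorial * 2 ^ ((2 * h + 1).factorial * dexp (i + κ)) ∣ p - 1)
    (hS : ∀ t < s, HasWindowPrimes (i + t) κ (3 * 2 ^ κ) n) :
    DenseDivIn (carmichael n) (1 + 1 / h) (Set.Icc (h : ℝ) (dexp (i + s + κ))) := by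
  obtain ⟨p, hp, hpn, hd⟩ := hL
  have hd := hd.trans (sub_one_dvd_carmichael hn hp hpn)
  refine fun y hy => exists_dvd_of_windows hh (carmichael_pos hn)
    ((dvd_mul_right _ _).trans hd) ((dvd_mul_left _ _).trans hd) hFi (n := s) (fun t ht => ?_)
    hy.1 hy.2
  obtain ⟨S, hS1, hS2⟩ := hS t ht
  refine ⟨S, hS1, fun q hq => ?_⟩
  obtain ⟨h1, h2, h3, p', hp', hpn', hqp⟩ := hS2 q hq
  exact ⟨h1, h2, h3, hqp.trans (sub_one_dvd_carmichael hn hp' hpn')⟩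

lemma summable_exp_neg_div_nat {k : ℕ} (hk : 0 < k) {a : ℝ} (ha : 0 < a) :
    Summable fun u : ℕ => Real.exp (-((u / k : ℕ) * a)) := by
  have hk' : (0 : ℝ) < k := by exact_mod_cast hk
  have h1 : Summable fun u : ℕ => Real.exp a * Real.exp (u * (-(a / k))) :=
    (Real.summable_exp_nat_mul_iff.2 (neg_neg_of_pos (by positivity))).mul_left _
  refine h1.of_nonneg_of_le (fun u => (Real.exp_pos _).le) fun u => ?_
  rw [← Real.exp_add]
  refine Real.exp_le_exp.2 ?_
  have h2 : u < k * (u / k + 1) := Nat.lt_mul_div_succ u hk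
  have h3 : (u : ℝ) < k * ((u / k : ℕ) + 1) := by exact_mod_cast h2
  have h4 : (u : ℝ) / k ≤ (u / k : ℕ) + 1 := by
    rw [div_le_iff₀ hk']
    linarith
  have h5 : (u : ℝ) * -(a / k) = -(u / k * a) := by ring
  rw [h5]
  nlinarith

lemma sum_exp_neg_min_le {k : ℕ} (hk : 0 < k) {a : ℝ} (ha : 0 < a) : ∃ B : ℝ, 0 < B ∧
    ∀ m : ℕ, ∑ s ∈ Finset.range m, Real.exp (-((min s (m - 1 - s) / k : ℕ) * a)) ≤ B := by
  let f : ℕ → ℝ := fun u => Real.exp (-((u / k : ℕ) * a))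
  have hf : Summable f := summable_exp_neg_div_nat hk ha
  have hf0 : ∀ u, 0 < f u := fun u => Real.exp_pos _
  refine ⟨2 * ∑' u, f u, mul_pos two_pos (hf.tsum_pos (fun u => (hf0 u).le) 0 (hf0 0)),
    fun m => ?_⟩
  have h1 : ∑ u ∈ Finset.range m, f u ≤ ∑' u, f u := hf.sum_le_tsum _ fun u _ => (hf0 u).le
  calc _ ≤ ∑ s ∈ Finset.range m, (f s + f (m - 1 - s)) := by
        refine Finset.sum_le_sum fun s _ => ?_
        rcases min_choice s (m - 1 - s) with h | h
        · rw [h]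
          exact le_add_of_nonneg_right (hf0 _).le
        · rw [h]
          exact le_add_of_nonneg_left (hf0 _).le
    _ ≤ _ := by
        rw [Finset.sum_add_distrib, Finset.sum_range_reflect]
        linarith

lemma summable_pow_div_dexp : Summable fun i : ℕ => (16 : ℝ) ^ i / dexp i := by
  have hpos : ∀ i, (0 : ℝ) < dexp i := fun i => by exact_mod_cast dexp_pos i
  refine summable_of_ratio_test_tendsto_lt_one zero_lt_one
    (Eventually.of_forall fun i => (div_pos (by positivity) (hpos i)).ne') ?_
  have h1 : Tendsto (fun i : ℕ => (16 : ℝ) / (dexp i : ℝ)) atTop (nhds 0) := by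
    refine Tendsto.div_atTop tendsto_const_nhds
      (tendsto_atTop_mono (fun i => ?_) tendsto_natCast_atTop_atTop)
    have h2 : i < 2 ^ i := Nat.lt_two_pow_self
    have h3 : 2 ^ i < dexp i := Nat.lt_two_pow_self
    exact_mod_cast (h2.trans h3).le
  refine h1.congr fun i => ?_
  rw [Real.norm_of_nonneg (div_pos (by positivity) (hpos _)).le,
    Real.norm_of_nonneg (div_pos (by positivity) (hpos _)).le, dexp_succ]
  have := hpos i
  push_cast
  field_simp
  ring

lemma eventually_sum_pow_div_dexp_le {ε : ℝ} (hε : 0 < ε) : ∀ᶠ i : ℕ in atTop, ∀ m : ℕ,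
    ∑ s ∈ Finset.range m, (16 : ℝ) ^ (i + s) / dexp (i + s) ≤ ε := by
  filter_upwards [(tendsto_sum_nat_add fun i : ℕ => (16 : ℝ) ^ i / dexp i).eventually
    (gt_mem_nhds hε)] with i hi m
  have h1 : Summable fun s : ℕ => (16 : ℝ) ^ (s + i) / dexp (s + i) :=
    (summable_nat_add_iff i).2 summable_pow_div_dexp
  simp only [add_comm i]
  exact (h1.sum_le_tsum _ fun s _ => by positivity).trans hi.le

lemma eventually_mul_sqrt_le (R : ℕ) {ε : ℝ} (hε : 0 < ε) : ∀ᶠ N : ℕ in atTop,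
    ∀ T, dexp T ≤ N → T * (R * √N) ≤ ε * N := by
  have hl : 0 < Real.log 2 := Real.log_pos (by norm_num)
  have hlo := (isLittleO_log_rpow_atTop (r := 1 / 2) (by norm_num)).bound
    (show 0 < ε * Real.log 2 / (R + 1) by positivity)
  filter_upwards [tendsto_natCast_atTop_atTop.eventually hlo, eventually_ge_atTop 1]
    with N hN hN1 T hT
  have hN1' : (1 : ℝ) ≤ N := by exact_mod_cast hN1
  rw [Real.norm_of_nonneg (Real.log_nonneg hN1'), Real.norm_of_nonneg (by positivity),
    ← Real.sqrt_eq_rpow] at hN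
  have h1 : T * Real.log 2 ≤ Real.log N := by
    calc T * Real.log 2 ≤ (2 ^ T : ℕ) * Real.log 2 := by
          have : T < 2 ^ T := Nat.lt_two_pow_self
          have : (T : ℝ) ≤ (2 ^ T : ℕ) := by exact_mod_cast this.le
          exact mul_le_mul_of_nonneg_right this hl.le
      _ = Real.log (dexp T) := by
          rw [dexp, Nat.cast_pow 2 (2 ^ T), Real.log_pow, Nat.cast_ofNat]
      _ ≤ Real.log N := Real.log_le_log (by exact_mod_cast dexp_pos T) (by exact_mod_cast hT)
  have hs : √(N : ℝ) * √N = N := Real.mul_self_sqrt (by linarith)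
  have hs0 : 0 ≤ √(N : ℝ) := Real.sqrt_nonneg _
  have hR : (0 : ℝ) < (R : ℝ) + 1 := by positivity
  have h2 : T * ((R : ℝ) + 1) ≤ ε * √N := by
    have h3 := h1.trans hN
    rw [div_mul_eq_mul_div, le_div_iff₀ hR] at h3
    nlinarith
  have h4 : (T : ℝ) * R ≤ ε * √N := by
    have : (0 : ℝ) ≤ T := Nat.cast_nonneg T
    nlinarith
  nlinarith

lemma dexp_pow_eight_le_sqrt {T N : ℕ} (h : dexp (T + 4) ≤ N) : (dexp T : ℝ) ^ 8 ≤ √N := by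
  refine Real.le_sqrt_of_sq_le ?_
  have h1 : (dexp T ^ 8) ^ 2 = dexp (T + 4) := by
    simp only [dexp_succ]
    ring
  rw [← h1] at h
  exact_mod_cast h

/-- Almost every `n ≤ N` has many prime factors in all windows, up to a power of `N`. -/
theorem exists_eventually_card_not_hasWindowPrimes_le : ∃ κ : ℕ, ∀ R : ℕ, 0 < R → ∀ i₁ : ℕ,
    ∀ ε : ℝ, 0 < ε → ∃ i ≥ i₁, ∃ A : ℕ, ∀ᶠ N : ℕ in atTop, ∀ T, dexp T ≤ N →
    (((Finset.Ioc 0 N).filter fun n =>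
      ¬ ∀ t < T - A, HasWindowPrimes (i + t) κ R n).card : ℝ) ≤ ε * N := by
  obtain ⟨C, hC, κ, j₀, hs⟩ := card_not_hasWindowPrimes_le
  refine ⟨κ, fun R hR i₁ ε hε => ?_⟩
  obtain ⟨B, hB, hBs⟩ := sum_exp_neg_min_le (k := 2 * R) (by omega)
    (show (0 : ℝ) < 1 / 64 by norm_num)
  have hε3 : 0 < ε / 3 := by positivity
  have hRpos : (0 : ℝ) < R := by exact_mod_cast hR
  have hexp : Tendsto (fun t : ℕ => R * C * B * Real.exp (-(t * (1 / 64)))) atTop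
      (nhds (R * C * B * 0)) :=
    (Real.tendsto_exp_neg_atTop_nhds_zero.comp
      (tendsto_natCast_atTop_atTop.atTop_mul_const (by norm_num))).const_mul _
  rw [mul_zero] at hexp
  obtain ⟨t₀, ht₀⟩ := (hexp.eventually (gt_mem_nhds hε3)).exists
  set D : ℕ := κ + 6 + R * t₀ with hD
  obtain ⟨i, hi, hij, hii⟩ := ((eventually_sum_pow_div_dexp_le
    (show 0 < ε / 3 / 4 ^ D by positivity)).and
      ((eventually_ge_atTop j₀).and (eventually_ge_atTop i₁))).exists
  refine ⟨i, hii, i + κ + 9 + R * t₀, ?_⟩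
  filter_upwards [eventually_mul_sqrt_le R hε3] with N hN T hT
  set m := T - (i + κ + 9 + R * t₀) with hm
  let τ : ℕ → ℕ := fun s => t₀ + min s (m - 1 - s) / (2 * R)
  have hτ : ∀ s, R * τ s ≤ R * t₀ + s ∧ R * τ s ≤ R * t₀ + (m - 1 - s) := fun s => by
    have h1 : 2 * R * (min s (m - 1 - s) / (2 * R)) ≤ min s (m - 1 - s) := Nat.mul_div_le _ _
    have h2 := min_le_left s (m - 1 - s)
    have h3 := min_le_right s (m - 1 - s)
    simp only [τ, mul_add]
    rw [mul_assoc] at h1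
    omega
  have hN0 : (0 : ℝ) ≤ N := Nat.cast_nonneg N
  have hterm : ∀ s ∈ Finset.range m,
      (((Finset.Ioc 0 N).filter fun n => ¬ HasWindowPrimes (i + s) κ R n).card : ℝ) ≤
      N * (R * C * Real.exp (-(t₀ * (1 / 64)))) *
        Real.exp (-((min s (m - 1 - s) / (2 * R) : ℕ) * (1 / 64))) + R * √N +
      N * 4 ^ D * (16 ^ (i + s) / dexp (i + s)) := fun s hsm => by
    have hsm := Finset.mem_range.1 hsm
    refine (hs (i + s) (by omega) R (τ s) N).trans ?_
    have h1 : Real.exp (-((τ s : ℝ) / 64)) = Real.exp (-(t₀ * (1 / 64))) *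
        Real.exp (-((min s (m - 1 - s) / (2 * R) : ℕ) * (1 / 64))) := by
      rw [← Real.exp_add]
      simp only [τ]
      push_cast
      ring_nf
    have h2 : (dexp (i + s + κ + 5 + R * τ s) : ℝ) ^ 8 ≤ √N :=
      dexp_pow_eight_le_sqrt ((dexp_mono (by have := (hτ s).2; omega)).trans hT)
    have h3 : (4 : ℝ) * 4 ^ (i + s + κ + 5 + R * τ s) ≤ 4 ^ D * 16 ^ (i + s) := by
      rw [show (16 : ℝ) = 4 ^ 2 by norm_num, ← pow_mul, ← pow_add, mul_comm, ← pow_succ]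
      exact pow_le_pow_right₀ (by norm_num) (by have := (hτ s).1; omega)
    have h4 : (4 : ℝ) * 4 ^ (i + s + κ + 5 + R * τ s) / dexp (i + s) ≤
        4 ^ D * 16 ^ (i + s) / dexp (i + s) :=
      div_le_div_of_nonneg_right h3 (Nat.cast_nonneg _)
    rw [h1]
    calc _ ≤ R * (C * N * (Real.exp (-(t₀ * (1 / 64))) *
        Real.exp (-((min s (m - 1 - s) / (2 * R) : ℕ) * (1 / 64)))) + √N) +
        N * (4 ^ D * 16 ^ (i + s) / dexp (i + s)) :=
          add_le_add (mul_le_mul_of_nonneg_left (add_le_add le_rfl h2) hRpos.le)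
            (mul_le_mul_of_nonneg_left h4 hN0)
      _ = _ := by ring
  have hsub : ((Finset.Ioc 0 N).filter fun n => ¬ ∀ t < m, HasWindowPrimes (i + t) κ R n) ⊆
      (Finset.range m).biUnion fun s =>
        (Finset.Ioc 0 N).filter fun n => ¬ HasWindowPrimes (i + s) κ R n := by
    intro n hn
    obtain ⟨hn1, hn2⟩ := Finset.mem_filter.1 hn
    push Not at hn2
    obtain ⟨t, ht, hn2⟩ := hn2
    exact Finset.mem_biUnion.2 ⟨t, Finset.mem_range.2 ht, Finset.mem_filter.2 ⟨hn1, hn2⟩⟩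
  calc _ ≤ ∑ s ∈ Finset.range m,
        (((Finset.Ioc 0 N).filter fun n => ¬ HasWindowPrimes (i + s) κ R n).card : ℝ) := by
        exact_mod_cast (Finset.card_le_card hsub).trans Finset.card_biUnion_le
    _ ≤ _ := Finset.sum_le_sum hterm
    _ = N * (R * C * Real.exp (-(t₀ * (1 / 64)))) * (∑ s ∈ Finset.range m,
          Real.exp (-((min s (m - 1 - s) / (2 * R) : ℕ) * (1 / 64)))) + m * (R * √N) +
        N * 4 ^ D * ∑ s ∈ Finset.range m, (16 : ℝ) ^ (i + s) / dexp (i + s) := by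
        rw [Finset.sum_add_distrib, Finset.sum_add_distrib, Finset.mul_sum, Finset.mul_sum,
          Finset.sum_const, Finset.card_range, nsmul_eq_mul]
    _ ≤ N * (ε / 3) + ε / 3 * N + N * (ε / 3) := by
        refine add_le_add (add_le_add ?_ ?_) ?_
        · calc _ ≤ N * (R * C * Real.exp (-(t₀ * (1 / 64)))) * B :=
                mul_le_mul_of_nonneg_left (hBs m) (by positivity)
            _ = N * (R * C * B * Real.exp (-(t₀ * (1 / 64)))) := by ring
            _ ≤ N * (ε / 3) := mul_le_mul_of_nonneg_left ht₀.le hN0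
        · refine le_trans ?_ (hN T hT)
          have : (m : ℝ) ≤ T := by exact_mod_cast Nat.sub_le _ _
          exact mul_le_mul_of_nonneg_right this (by positivity)
        · calc _ ≤ N * 4 ^ D * (ε / 3 / 4 ^ D) :=
                mul_le_mul_of_nonneg_left (hi m) (by positivity)
            _ = N * (ε / 3) := by
                have : (4 : ℝ) ^ D ≠ 0 := by positivity
                field_simp
    _ = ε * N := by ring

lemma exists_dexp_le_lt {N : ℕ} (hN : 2 ≤ N) : ∃ T, dexp T ≤ N ∧ N < dexp (T + 1) := by
  refine ⟨Nat.log 2 (Nat.log 2 N), ?_, ?_⟩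
  · refine (Nat.pow_le_pow_right two_pos (Nat.pow_log_le_self 2 ?_)).trans
      (Nat.pow_log_le_self 2 (by omega))
    exact (Nat.log_pos one_lt_two hN).ne'
  · exact (Nat.lt_pow_succ_log_self one_lt_two N).trans_le
      (Nat.pow_le_pow_right two_pos (Nat.lt_pow_succ_log_self one_lt_two _))

lemma rpow_le_dexp {x : ℝ} {A T a : ℕ} (hx0 : 0 ≤ x) (hx : x ≤ dexp (T + 1)) (ha : T - A ≤ a) :
    x ^ (1 / 2 ^ (A + 1) : ℝ) ≤ dexp a := by
  have h1 : (T + 1 : ℕ) ≤ A + 1 + a := by omega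
  calc x ^ (1 / 2 ^ (A + 1) : ℝ) ≤ (dexp (A + 1 + a) : ℝ) ^ (1 / 2 ^ (A + 1) : ℝ) :=
        Real.rpow_le_rpow hx0 (hx.trans (by exact_mod_cast dexp_mono h1)) (by positivity)
    _ = dexp a := by
        have h2 : dexp (A + 1 + a) = dexp a ^ 2 ^ (A + 1) := by
          rw [dexp, dexp, ← pow_mul, pow_add 2 (A + 1) a, mul_comm]
        rw [h2]
        push_cast
        rw [← Real.rpow_natCast, ← Real.rpow_mul (Nat.cast_nonneg _)]
        push_cast
        rw [mul_one_div_cancel (by positivity), Real.rpow_one]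

theorem stmt_7 (h : ℕ) (hh : 0 < h) (δ : ℝ) (hδ0 : 0 < δ) (hδ1 : δ < 1) :
    ∃ c : ℝ, 0 < c ∧ ∀ᶠ x : ℝ in atTop,
      (1 - δ) * x < (((Finset.Icc 1 ⌊x⌋₊).filter
        (fun n => DenseDivIn (Nat.totient n) (1 + 1 / h) (Set.Icc (h : ℝ) (x ^ c)) ∧
                  DenseDivIn (carmichael n) (1 + 1 / h) (Set.Icc (h : ℝ) (x ^ c)))).card : ℝ) := by
  have hε : 0 < δ / 4 := by positivity
  obtain ⟨κ, hκ⟩ := exists_eventually_card_not_hasWindowPrimes_le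
  obtain ⟨i, hi, A, hA⟩ := hκ (3 * 2 ^ κ) (by positivity) (2 * h + 1).factorial (δ / 4) hε
  set L := (2 * h + 1).factorial * 2 ^ ((2 * h + 1).factorial * dexp (i + κ)) with hL
  have hFi : (2 * h + 1).factorial ≤ dexp (i + κ) := by
    have h1 : i < 2 ^ i := Nat.lt_two_pow_self
    have h2 : 2 ^ i < dexp i := Nat.lt_two_pow_self
    have h3 : dexp i ≤ dexp (i + κ) := dexp_mono (by omega)
    omega
  have hB := eventually_card_not_exists_prime_residueClass_le
    (L := L) (Nat.mul_pos (Nat.factorial_pos _) (by positivity)) hε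
  refine ⟨1 / 2 ^ (A + 1), by positivity, ?_⟩
  filter_upwards [tendsto_nat_floor_atTop.eventually (hA.and hB),
    eventually_ge_atTop 2, eventually_gt_atTop (1 / (δ / 4))] with x ⟨hAx, hBx⟩ hx2 hxδ
  rw [div_lt_iff₀ hε] at hxδ
  set N := ⌊x⌋₊ with hN
  have hN2 : 2 ≤ N := Nat.le_floor (by exact_mod_cast hx2)
  obtain ⟨T, hT1, hT2⟩ := exists_dexp_le_lt hN2
  have hxT : x ≤ dexp (T + 1) :=
    (Nat.lt_of_floor_lt hT2).le
  have hAx := hAx T hT1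
  have hsub : Finset.Ioc 0 N ⊆ ((Finset.Icc 1 N).filter (fun n =>
      DenseDivIn (Nat.totient n) (1 + 1 / h) (Set.Icc (h : ℝ) (x ^ (1 / 2 ^ (A + 1) : ℝ))) ∧
      DenseDivIn (carmichael n) (1 + 1 / h) (Set.Icc (h : ℝ) (x ^ (1 / 2 ^ (A + 1) : ℝ))))) ∪
      (((Finset.Ioc 0 N).filter fun n =>
        ¬ ∀ t < T - A, HasWindowPrimes (i + t) κ (3 * 2 ^ κ) n) ∪
      (Finset.Ioc 0 N).filter fun n => ¬ ∃ p, p.Prime ∧ p ∣ n ∧ L ∣ p - 1) := by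
    intro n hn
    rw [Finset.mem_union, Finset.mem_union, Finset.mem_filter, Finset.mem_filter,
      Finset.mem_filter]
    by_cases h1 : ∀ t < T - A, HasWindowPrimes (i + t) κ (3 * 2 ^ κ) n
    · by_cases h2 : ∃ p, p.Prime ∧ p ∣ n ∧ L ∣ p - 1
      · rw [Finset.mem_Ioc] at hn
        have h3 : DenseDivIn (carmichael n) (1 + 1 / h)
            (Set.Icc (h : ℝ) (x ^ (1 / 2 ^ (A + 1) : ℝ))) := fun y hy =>
          denseDivIn_carmichael hh hn.1 hFi h2 h1 y
            ⟨hy.1, hy.2.trans (rpow_le_dexp (by linarith) hxT (by omega))⟩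
        exact Or.inl ⟨Finset.mem_Icc.2 ⟨hn.1, hn.2⟩,
          h3.of_dvd (carmichael_dvd_totient hn.1), h3⟩
      · exact Or.inr (Or.inr ⟨hn, h2⟩)
    · exact Or.inr (Or.inl ⟨hn, h1⟩)
  have hcard := (Finset.card_le_card hsub).trans ((Finset.card_union_le _ _).trans
    (Nat.add_le_add_left (Finset.card_union_le _ _) _))
  rw [Nat.card_Ioc, Nat.sub_zero, ← Nat.cast_le (α := ℝ)] at hcard
  push_cast at hcard
  have hNx : x < N + 1 := Nat.lt_floor_add_one x
  have hNx' : (N : ℝ) ≤ x := Nat.floor_le (by linarith)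
  nlinarith
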